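/- arXiv:1711.09656 — 4 statements merged into one kernel-verified Lean document; each statement's English description precedes it below -/
import Mathlib

section
/- Every connected K_4-free bridged graph satisfies Property A. (Graph formulation of the Main Theorem: two-dimensional systolic complexes satisfy Property A, stated for their 1-skeleta.) -/
/-- A graph is `K_4`-free if it has no four pairwise adjacent vertices. -/
def K4Free {V : Type*} (G : SimpleGraph V) : Prop :=
  ¬ ∃ a b c d : V, G.Adj a b ∧ G.Adj a c ∧ G.Adj a d ∧ G.Adj b c ∧ G.Adj b d ∧ G.Adj c d

/-- `f : ZMod n → V` is an isometric cycle of length `n` in `G`: an embedded cycle such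
that the distance in `G` between any two of its vertices equals their distance along the
cycle, which is `min (i - j).val ((j - i).val)`. -/
def IsIsometricCycle {V : Type*} (G : SimpleGraph V) (n : ℕ) (f : ZMod n → V) : Prop :=
  3 ≤ n ∧ Function.Injective f ∧
    (∀ i : ZMod n, G.Adj (f i) (f (i + 1))) ∧
    (∀ i j : ZMod n, G.dist (f i) (f j) = min (i - j).val (j - i).val)

/-- A graph is bridged if every isometric cycle in it has length 3. -/
def Bridged {V : Type*} (G : SimpleGraph V) : Prop :=
  ∀ (n : ℕ) (f : ZMod n → V), IsIsometricCycle G n f → n = 3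

/-- A graph `G` satisfies Property A if there are constants `C n` and finitely
supported nonzero functions `f n v : V → ℕ` such that `f n v` is supported on the ball
of radius `C n` about `v` and `‖f n v - f n v'‖₁ / ‖f n v‖₁ → 0` uniformly over
pairs of adjacent vertices `(v, v')`. -/
def PropertyA {V : Type*} (G : SimpleGraph V) : Prop :=
  ∃ (C : ℕ → ℕ) (f : ℕ → V → V → ℕ),
    (∀ n v, (Function.support (f n v)).Finite) ∧
    (∀ n v, f n v ≠ 0) ∧
    (∀ n v w, f n v w ≠ 0 → G.dist v w ≤ C n) ∧
    (∀ ε : ℝ, 0 < ε → ∃ N : ℕ, ∀ n, N ≤ n → ∀ v v' : V, G.Adj v v' →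
      (∑ᶠ w, |((f n v w : ℝ)) - (f n v' w : ℝ)|) / (∑ᶠ w, (f n v w : ℝ)) < ε)


namespace SimpleGraph

variable {V : Type*} {G : SimpleGraph V}

theorem Connected.dist_le_dist_add_one (hG : G.Connected) (c : V) {x y : V} (h : G.Adj x y) :
    G.dist c x ≤ G.dist c y + 1 := by
  have := hG.dist_triangle (u := c) (v := y) (w := x)
  rw [dist_eq_one_iff_adj.2 h.symm] at this
  exact this

/-- A geodesic from `a` to `b` through a prescribed vertex of the interval between them. -/
theorem Connected.exists_geodesic_through (hG : G.Connected) {a u b : V} {m n : ℕ}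
    (hm : G.dist a u = m) (hn : G.dist a b = n) (h : G.dist a u + G.dist u b = G.dist a b) :
    ∃ p : ℕ → V, p 0 = a ∧ p m = u ∧ p n = b ∧
      ∀ i j, i ≤ j → j ≤ n → G.dist (p i) (p j) = j - i := by
  obtain ⟨P, hP⟩ := hG.exists_walk_length_eq_dist a u
  obtain ⟨Q, hQ⟩ := hG.exists_walk_length_eq_dist u b
  have hl : (P.append Q).length = n := by simp [hP, hQ, h, hn]
  have h0 : (P.append Q).getVert 0 = a := by simp
  have hb : (P.append Q).getVert n = b := by rw [← hl]; exact Walk.getVert_length _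
  have step : ∀ i d, i + d ≤ n →
      G.dist ((P.append Q).getVert i) ((P.append Q).getVert (i + d)) ≤ d := by
    intro i d
    induction d with
    | zero => simp
    | succ d ih =>
      intro hd
      have hadj := (P.append Q).adj_getVert_succ (i := i + d) (by omega)
      have := hG.dist_le_dist_add_one ((P.append Q).getVert i) hadj.symm
      rw [← add_assoc]
      have := ih (by omega)
      omega
  refine ⟨(P.append Q).getVert, h0, ?_, hb, ?_⟩
  · rw [Walk.getVert_append]
    simp [← hm, ← hP]
  · intro i j hij hj
    have h1 := step 0 i (by omega)
    have h2 := step i (j - i) (by omega)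
    have h3 := step j (n - j) (by omega)
    rw [Nat.add_sub_cancel' hij] at h2
    rw [Nat.add_sub_cancel' hj, hb] at h3
    rw [Nat.zero_add, h0] at h1
    have h4 := hG.dist_triangle (u := a) (v := (P.append Q).getVert i) (w := b)
    have h5 := hG.dist_triangle (u := (P.append Q).getVert i)
      (v := (P.append Q).getVert j) (w := b)
    omega

end SimpleGraph

open SimpleGraph

section

variable {V : Type*} {G : SimpleGraph V}

/-- In a bridged graph, a cyclic sequence of vertices realising the cycle distances has
length three. -/
theorem Bridged.length_eq_three (hbr : Bridged G) {n : ℕ} (hn : 3 ≤ n)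
    (c : ℕ → V) (h : ∀ i j, i < j → j < n → G.dist (c i) (c j) = min (j - i) (n - (j - i))) :
    n = 3 := by
  have : NeZero n := ⟨by omega⟩
  have key : ∀ i j : ZMod n, G.dist (c i.val) (c j.val) = min (i - j).val (j - i).val := by
    have aux : ∀ i j : ZMod n, i.val < j.val →
        G.dist (c i.val) (c j.val) = min (i - j).val (j - i).val := by
      intro i j hij
      have h1 : (j - i).val = j.val - i.val := ZMod.val_sub hij.le
      have h2 : (i - j).val = n - (j.val - i.val) := by
        rw [← neg_sub, ZMod.neg_val, if_neg, h1]
        intro h0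
        rw [sub_eq_zero] at h0
        simp [h0] at hij
      rw [h _ _ hij (ZMod.val_lt j), h1, h2, min_comm]
    intro i j
    rcases lt_trichotomy i.val j.val with hlt | heq | hlt
    · exact aux i j hlt
    · rw [ZMod.val_injective n heq]; simp
    · rw [SimpleGraph.dist_comm, aux j i hlt, min_comm]
  refine hbr n (fun i => c i.val) ⟨hn, ?_, ?_, key⟩
  · intro i j hij
    have h0 := key i j
    simp only at hij
    rw [hij, dist_self] at h0
    rcases Nat.min_eq_zero_iff.1 h0.symm with h | h
    · exact sub_eq_zero.1 ((ZMod.val_eq_zero _).1 h)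
    · exact (sub_eq_zero.1 ((ZMod.val_eq_zero _).1 h)).symm
  · intro i
    rw [← dist_eq_one_iff_adj, key]
    have : Fact (1 < n) := ⟨by omega⟩
    have h1 : (1 : ZMod n).val = 1 := ZMod.val_one n
    have h2 : (-1 : ZMod n).val = n - 1 := by
      rw [ZMod.neg_val, if_neg one_ne_zero, h1]
    simp only [sub_add_cancel_left, add_sub_cancel_left, h1, h2]
    omega

theorem dist_eq_two (hG : G.Connected) {a b x : V} (h1 : G.Adj a x) (h2 : G.Adj x b)
    (hne : a ≠ b) (hab : ¬ G.Adj a b) : G.dist a b = 2 := by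
  have h3 := hG.dist_le_dist_add_one a h2.symm
  rw [dist_eq_one_iff_adj.2 h1] at h3
  have h4 : G.dist a b ≠ 0 := fun h => hne (hG.dist_eq_zero_iff.1 h)
  have h5 : G.dist a b ≠ 1 := fun h => hab (dist_eq_one_iff_adj.1 h)
  omega

theorem Bridged.chord_of_four_cycle (hG : G.Connected) (hbr : Bridged G) {a b c d : V}
    (hab : G.Adj a b) (hbc : G.Adj b c) (hcd : G.Adj c d) (hda : G.Adj d a)
    (hac : a ≠ c) (hbd : b ≠ d) : G.Adj a c ∨ G.Adj b d := by
  by_contra! hcon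
  have h1 := dist_eq_two hG hab hbc hac hcon.1
  have h2 := dist_eq_two hG hbc hcd hbd hcon.2
  have h3 := dist_eq_one_iff_adj.2 hab
  have h4 := dist_eq_one_iff_adj.2 hbc
  have h5 := dist_eq_one_iff_adj.2 hcd
  have h6 := dist_eq_one_iff_adj.2 hda.symm
  have := hbr.length_eq_three (n := 4) (by omega)
    (fun i => match i with | 0 => a | 1 => b | 2 => c | _ => d) (by
      intro i j hij hj
      interval_cases j <;> interval_cases i <;> simp [*])
  omega

theorem Bridged.chord_of_five_cycle (hG : G.Connected) (hbr : Bridged G) {a b c d e : V}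
    (hab : G.Adj a b) (hbc : G.Adj b c) (hcd : G.Adj c d) (hde : G.Adj d e) (hea : G.Adj e a)
    (hac : a ≠ c) (had : a ≠ d) (hbd : b ≠ d) (hbe : b ≠ e) (hce : c ≠ e) :
    G.Adj a c ∨ G.Adj a d ∨ G.Adj b d ∨ G.Adj b e ∨ G.Adj c e := by
  by_contra! hcon
  have h1 := dist_eq_two hG hab hbc hac hcon.1
  have h2 := dist_eq_two hG hea.symm hde.symm had hcon.2.1
  have h3 := dist_eq_two hG hbc hcd hbd hcon.2.2.1
  have h4 := dist_eq_two hG hab.symm hea.symm hbe hcon.2.2.2.1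
  have h5 := dist_eq_two hG hcd hde hce hcon.2.2.2.2
  have h6 := dist_eq_one_iff_adj.2 hab
  have h7 := dist_eq_one_iff_adj.2 hbc
  have h8 := dist_eq_one_iff_adj.2 hcd
  have h9 := dist_eq_one_iff_adj.2 hde
  have h10 := dist_eq_one_iff_adj.2 hea.symm
  have := hbr.length_eq_three (n := 5) (by omega)
    (fun i => match i with | 0 => a | 1 => b | 2 => c | 3 => d | _ => e) (by
      intro i j hij hj
      interval_cases j <;> interval_cases i <;> simp [*])
  omega

/-- The neighbours, closer to `c`, of a vertex at distance `m` from `c` form a clique. -/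
def ParentsClique (G : SimpleGraph V) (c : V) (m : ℕ) : Prop :=
  ∀ v x y : V, G.Adj v x → G.Adj v y → G.dist c v = m → G.dist c x + 1 = m →
    G.dist c y + 1 = m → x = y ∨ G.Adj x y

/-- Adjacent vertices at distance `m > 0` from `c` have a common neighbour closer to `c`. -/
def CommonParent (G : SimpleGraph V) (c : V) (m : ℕ) : Prop :=
  ∀ x y : V, G.Adj x y → G.dist c x = m → G.dist c y = m → 0 < m →
    ∃ z, G.Adj z x ∧ G.Adj z y ∧ G.dist c z + 1 = m

/-- Along a geodesic, the distance from `c` cannot decrease after an initial increase. -/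
theorem dist_le_dist_succ_of_rise (hG : G.Connected) {c : V} {q : ℕ → V} {n : ℕ}
    (hq : ∀ i j, i ≤ j → j ≤ n → G.dist (q i) (q j) = j - i)
    (hA : ∀ i ≤ n, ParentsClique G c (G.dist c (q i)))
    (hB : ∀ i ≤ n, CommonParent G c (G.dist c (q i)))
    (h1 : G.dist c (q 1) = G.dist c (q 0) + 1) :
    ∀ i, i + 1 ≤ n → G.dist c (q i) ≤ G.dist c (q (i + 1)) ∧
      ∃ z, G.Adj z (q (i + 1)) ∧ G.dist c z + 1 = G.dist c (q (i + 1)) ∧ G.dist (q 0) z ≤ i := by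
  have hadj : ∀ i, i + 1 ≤ n → G.Adj (q i) (q (i + 1)) := fun i hi => by
    rw [← dist_eq_one_iff_adj, hq i (i + 1) (by omega) hi]; omega
  intro i
  induction i with
  | zero => exact fun h => ⟨by simp [h1], q 0, hadj 0 h, by simp [h1], by simp⟩
  | succ i ih =>
    intro hi
    obtain ⟨-, z, hz, hzc, hzq⟩ := ih (by omega)
    have ha := hadj (i + 1) hi
    have l1 := hG.dist_le_dist_add_one c ha
    have l2 := hG.dist_le_dist_add_one c ha.symm
    rcases Nat.lt_trichotomy (G.dist c (q (i + 1))) (G.dist c (q (i + 1 + 1))) with h | h | h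
    · exact ⟨h.le, q (i + 1), ha, by omega, by rw [hq 0 (i + 1) (by omega) (by omega)]; omega⟩
    · obtain ⟨w, hw1, hw2, hwc⟩ := hB (i + 1) (by omega) _ _ ha rfl h.symm (by omega)
      refine ⟨h.le, w, hw2, by omega, ?_⟩
      rcases hA (i + 1) (by omega) _ _ _ hz.symm hw1.symm rfl hzc hwc with e | e
      · subst e; omega
      · have := hG.dist_le_dist_add_one (q 0) e.symm
        omega
    · exfalso
      have h2 := hq 0 (i + 1 + 1) (by omega) hi
      rcases hA (i + 1) (by omega) _ _ _ hz.symm ha rfl hzc (by omega) with e | e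
      · rw [← e] at h2; omega
      · have := hG.dist_le_dist_add_one (q 0) e.symm
        omega

theorem dist_eq_of_nonadj_parents (hG : G.Connected) (hbr : Bridged G) {k : ℕ}
    (hA : ∀ j < k, ∀ c, ParentsClique G c j) (hB : ∀ j < k, ∀ c, CommonParent G c j)
    {o v x y u : V} (hv : G.dist o v = k) (hvx : G.Adj v x) (hvy : G.Adj v y)
    (hx : G.dist o x + 1 = k) (hy : G.dist o y + 1 = k) (hne : x ≠ y) (hxy : ¬ G.Adj x y)
    (hu : G.dist o u + G.dist u x + 1 = k) (hu0 : 0 < G.dist o u) :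
    G.dist u y = G.dist u x + 2 := by
  have t1 := hG.dist_triangle (u := o) (v := u) (w := v)
  have t2 := hG.dist_le_dist_add_one u hvx
  have t3 := hG.dist_le_dist_add_one u hvy
  have t4 := hG.dist_le_dist_add_one u hvy.symm
  by_contra hcon
  rcases Nat.lt_or_ge (G.dist u x) (G.dist u y) with h | h
  · obtain ⟨z, hzv, hzy, hz⟩ := hB (G.dist u x + 1) (by omega) u v y hvy (by omega) (by omega)
      (by omega)
    rcases hA (G.dist u x + 1) (by omega) u v x z hvx hzv.symm (by omega) rfl hz with e | hxz
    · exact hxy (e ▸ hzy)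
    · have t5 := hG.dist_triangle (u := o) (v := u) (w := z)
      have t6 := hG.dist_le_dist_add_one o hzv.symm
      have hx' : G.dist o x = k - 1 := by omega
      have hy' : G.dist o y = k - 1 := by omega
      have hz' : G.dist o z = k - 1 := by omega
      obtain ⟨a, hax, haz, ha⟩ := hB (k - 1) (by omega) o x z hxz hx' hz' (by omega)
      obtain ⟨b, hbz, hby, hb⟩ := hB (k - 1) (by omega) o z y hzy hz' hy' (by omega)
      have nva : v ≠ a := by rintro rfl; omega
      have nvb : v ≠ b := by rintro rfl; omega
      have ava : ¬ G.Adj v a := fun h => by have := hG.dist_le_dist_add_one o h; omega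
      have avb : ¬ G.Adj v b := fun h => by have := hG.dist_le_dist_add_one o h; omega
      have nay : ¬ G.Adj a y := fun h =>
        (hbr.chord_of_four_cycle hG hvx hax.symm h hvy.symm nva hne).elim ava hxy
      have nxb : ¬ G.Adj x b := fun h =>
        (hbr.chord_of_four_cycle hG hvx h hby hvy.symm nvb hne).elim avb hxy
      rcases hA (k - 1) (by omega) o z a b haz.symm hbz.symm hz' ha hb with e | hab
      · exact nay (e ▸ hby)
      · have := hbr.chord_of_five_cycle hG hvx hax.symm hab hby hvy.symm nva nvb
          (by rintro rfl; omega) hne (by rintro rfl; omega)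
        tauto
  · exact (hA (G.dist u x + 1) (by omega) u v x y hvx hvy (by omega) rfl (by omega)).elim
      hne hxy

theorem parentsClique_of_lt (hG : G.Connected) (hbr : Bridged G) {k : ℕ}
    (hA : ∀ j < k, ∀ c, ParentsClique G c j) (hB : ∀ j < k, ∀ c, CommonParent G c j) (o : V) :
    ParentsClique G o k := by
  intro v x y hvx hvy hv hx hy
  by_contra! hcon
  obtain ⟨hne, hxy⟩ := hcon
  have hk : 2 ≤ k := by
    by_contra hk
    have h1 : G.dist o x = 0 := by omega
    have h2 : G.dist o y = 0 := by omega
    exact hne ((hG.dist_eq_zero_iff.1 h1).symm.trans (hG.dist_eq_zero_iff.1 h2))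
  obtain ⟨p, p0, px, pv, hp⟩ := hG.exists_geodesic_through (a := o) (u := x) (b := v)
    (m := k - 1) (n := k) (by omega) hv (by rw [dist_eq_one_iff_adj.2 hvx.symm]; omega)
  obtain ⟨q, q0, qy, qv, hq⟩ := hG.exists_geodesic_through (a := o) (u := y) (b := v)
    (m := k - 1) (n := k) (by omega) hv (by rw [dist_eq_one_iff_adj.2 hvy.symm]; omega)
  have op : ∀ s ≤ k, G.dist o (p s) = s := fun s hs => by
    have := hp 0 s (by omega) hs; rw [p0] at this; omega
  have oq : ∀ s ≤ k, G.dist o (q s) = s := fun s hs => by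
    have := hq 0 s (by omega) hs; rw [q0] at this; omega
  have vp : ∀ s ≤ k, G.dist (p s) v = k - s := fun s hs => by
    have := hp s k hs le_rfl; rwa [pv] at this
  have vq : ∀ s ≤ k, G.dist (q s) v = k - s := fun s hs => by
    have := hq s k hs le_rfl; rwa [qv] at this
  have E1 : ∀ s, 1 ≤ s → s < k → G.dist (p s) y = k - s + 1 := by
    intro s hs hsk
    have h1 := hp s (k - 1) (by omega) (by omega)
    rw [px] at h1
    have h2 := op s hsk.le
    have := dist_eq_of_nonadj_parents hG hbr hA hB hv hvx hvy hx hy hne hxy (u := p s)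
      (by omega) (by omega)
    omega
  have hne1 : p 1 ≠ q 1 := fun e => by
    have h1 := E1 1 le_rfl (by omega)
    have h2 := hq 1 (k - 1) (by omega) (by omega)
    rw [qy, ← e] at h2
    omega
  have hadj1 : ¬ G.Adj (p 1) (q 1) := fun e => by
    have h1 := E1 1 le_rfl (by omega)
    have h2 := hq 1 (k - 1) (by omega) (by omega)
    rw [qy, SimpleGraph.dist_comm] at h2
    have h3 := hG.dist_le_dist_add_one y e
    rw [SimpleGraph.dist_comm] at h3
    omega
  have E2 : ∀ s, 1 ≤ s → s < k → G.dist (p s) (q 1) = s + 1 := by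
    intro s hs hsk
    have h1 := hp 1 s (by omega) (by omega)
    have h2 := vp s hsk.le
    have h3 := vp 1 (by omega)
    have h4 := vq 1 (by omega)
    rw [SimpleGraph.dist_comm] at h1 h2 h3 h4
    have h5 := dist_eq_one_iff_adj.1 (op 1 (by omega))
    have h6 := dist_eq_one_iff_adj.1 (oq 1 (by omega))
    have := dist_eq_of_nonadj_parents hG hbr hA hB (o := v) (v := o)
      (by rw [SimpleGraph.dist_comm]; exact hv) h5 h6 (by omega) (by omega) hne1 hadj1 (u := p s)
      (by omega) (by omega)
    omega
  have main : ∀ s t, 1 ≤ s → s < k → 1 ≤ t → t < k →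
      G.dist (p s) (q t) = min (s + t) (2 * k - (s + t)) := by
    intro s t hs hsk ht htk
    have up1 : ∀ i ≤ k, G.dist (p s) (q i) ≤ s + i := fun i hi => by
      have := hG.dist_triangle (u := p s) (v := o) (w := q i)
      rw [oq i hi, SimpleGraph.dist_comm (u := p s) (v := o), op s hsk.le] at this
      exact this
    have up2 : ∀ i ≤ k, G.dist (p s) (q i) ≤ (k - s) + (k - i) := fun i hi => by
      have := hG.dist_triangle (u := p s) (v := v) (w := q i)
      rw [vp s hsk.le, SimpleGraph.dist_comm (u := v), vq i hi] at this
      exact this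
    by_cases hpk : G.dist (p s) (q (k - s)) = k
    · have h1 := hG.dist_triangle (u := p s) (v := q t) (w := q (k - s))
      have h2 := up1 t htk.le
      have h3 := up2 t htk.le
      rcases le_total t (k - s) with h | h
      · rw [hq _ _ h (by omega)] at h1
        omega
      · rw [SimpleGraph.dist_comm (u := q t), hq _ _ h (by omega)] at h1
        omega
    · exfalso
      have low : ∀ i ≤ k, G.dist (p s) (q i) < k := fun i hi => by
        have h1 := up1 i hi
        have h2 := up2 i hi
        by_contra h3
        have h4 : i = k - s := by omega
        subst h4
        omega
      have := (dist_le_dist_succ_of_rise hG (c := p s) (q := fun i => q (k - i)) (n := k)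
        (fun i j hij hj => by
          rw [SimpleGraph.dist_comm, hq _ _ (by omega) (by omega)]; omega)
        (fun i _ => hA _ (low _ (by omega)) _) (fun i _ => hB _ (low _ (by omega)) _)
        (by simp only [Nat.sub_zero, qy, qv]; rw [E1 s hs hsk, vp s hsk.le]) (k - 1)
        (by omega)).1
      simp only [show k - (k - 1) = 1 by omega, show k - (k - 1 + 1) = 0 by omega, q0] at this
      rw [E2 s hs hsk, SimpleGraph.dist_comm, op s hsk.le] at this
      omega
  have := hbr.length_eq_three (n := 2 * k) (by omega)
    (fun i => if i ≤ k then p i else q (2 * k - i)) (by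
      intro i j hij hj
      rcases le_or_gt j k with hjk | hjk
      · simp only [hjk, show i ≤ k by omega, if_true]
        rw [hp i j hij.le hjk]; omega
      · rcases le_or_gt i k with hik | hik
        · simp only [hik, not_le.2 hjk, if_true, if_false]
          rcases Nat.eq_zero_or_pos i with rfl | hi
          · rw [p0, oq _ (by omega)]; omega
          · rcases Nat.lt_or_ge i k with hik' | hik'
            · rw [main i _ hi hik' (by omega) (by omega)]; omega
            · obtain rfl : i = k := by omega
              rw [pv, SimpleGraph.dist_comm, vq _ (by omega)]; omega
        · simp only [not_le.2 hjk, not_le.2 hik, if_false]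
          rw [SimpleGraph.dist_comm, hq _ _ (by omega) (by omega)]; omega)
  omega

theorem eq_or_lt_of_no_peak {g : ℕ → ℕ} {k s : ℕ} (hs : 2 ≤ s) (hsk : s < k)
    (up1 : ∀ i ≤ k, g i ≤ s + i) (up2 : ∀ i ≤ k, g i ≤ (k - s + 1) + (k - i))
    (peak : ∀ i, 0 < i → i < k → g i = k → g (i - 1) < k → g (i + 1) < k → False) :
    (g (k - s) = k ∧ g (k - s + 1) = k) ∨ ∀ i ≤ k, g i < k := by
  have v1 := up1 (k - s - 1) (by omega)
  have v4 := up2 (k - s + 1 + 1) (by omega)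
  have v5 := up1 (k - s) (by omega)
  have v6 := up2 (k - s + 1) (by omega)
  have pk1 := peak (k - s) (by omega) (by omega)
  have pk2 := peak (k - s + 1) (by omega) (by omega)
  rw [Nat.add_sub_cancel] at pk2
  by_cases h1 : g (k - s) = k
  · by_cases h2 : g (k - s + 1) = k
    · exact .inl ⟨h1, h2⟩
    · exact (pk1 h1 (by omega) (by omega)).elim
  · right
    have h2 : g (k - s + 1) ≠ k := fun h => pk2 h (by omega) (by omega)
    intro i hi
    have h3 := up1 i hi
    have h4 := up2 i hi
    by_contra h5
    have h6 : i = k - s ∨ i = k - s + 1 := by omega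
    rcases h6 with rfl | rfl <;> omega

theorem commonParent_of_lt (hG : G.Connected) (hbr : Bridged G) {k : ℕ}
    (hA : ∀ j ≤ k, ∀ c, ParentsClique G c j) (hB : ∀ j < k, ∀ c, CommonParent G c j) (o : V) :
    CommonParent G o k := by
  intro x y hxy hx hy hk0
  by_contra! hcon
  have hk : 2 ≤ k := by
    by_contra hk
    obtain rfl : k = 1 := by omega
    exact hcon o (dist_eq_one_iff_adj.1 hx) (dist_eq_one_iff_adj.1 hy) (by simp)
  -- a vertex of a geodesic from `o` to `x` is no closer to `y` than expected
  have F1 : ∀ x y : V, G.Adj x y → G.dist o x = k → G.dist o y = k →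
      (∀ z, G.Adj z x → G.Adj z y → G.dist o z + 1 ≠ k) →
      ∀ u, G.dist o u + G.dist u x = k → 0 < G.dist o u → G.dist u y = G.dist u x + 1 := by
    intro x y hxy hx hy hcon u hu hu0
    have t1 := hG.dist_triangle (u := o) (v := u) (w := y)
    have t2 := hG.dist_le_dist_add_one u hxy.symm
    by_contra hne
    have h1 : G.dist u y = G.dist u x := by omega
    have h2 : 0 < G.dist u x := by
      by_contra h0
      have e1 := hG.dist_eq_zero_iff.1 (show G.dist u x = 0 by omega)
      have e2 := hG.dist_eq_zero_iff.1 (show G.dist u y = 0 by omega)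
      exact hxy.ne (e1.symm.trans e2)
    obtain ⟨z, hzx, hzy, hz⟩ := hB (G.dist u x) (by omega) u x y hxy rfl h1 h2
    have t3 := hG.dist_triangle (u := o) (v := u) (w := z)
    have t4 := hG.dist_le_dist_add_one o hzx.symm
    exact hcon z hzx hzy (by omega)
  have F1y := F1 y x hxy.symm hy hx (fun z h1 h2 => hcon z h2 h1)
  replace F1 := F1 x y hxy hx hy hcon
  have F2 : ∀ u y' : V, G.dist o u + G.dist u x = k → 0 < G.dist o u → G.Adj y y' →
      G.dist o y' + 1 = k → G.dist u x + 1 ≤ G.dist u y' := by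
    intro u y' hu hu0 hyy hy'
    have h1 := F1 u hu hu0
    have h2 := hG.dist_le_dist_add_one u hyy
    by_contra hlt
    rcases hA (G.dist u x + 1) (by omega) u y x y' hxy.symm hyy h1 rfl (by omega) with e | e
    · subst e; omega
    · exact hcon y' e.symm hyy.symm hy'
  have F3 : ∀ u y' : V, G.dist o u + G.dist u x = k → 2 ≤ G.dist o u → 0 < G.dist u x →
      G.Adj y y' → G.dist o y' + 1 = k → G.dist u y' = G.dist u x + 2 := by
    intro u y' hu hu0 hux hyy hy'
    have h1 := F1 u hu (by omega)
    have h2 := F2 u y' hu (by omega) hyy hy'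
    have h3 := hG.dist_le_dist_add_one u hyy.symm
    by_contra hne
    obtain ⟨z, hzy, hzy', hz⟩ := hB (G.dist u x + 1) (by omega) u y y' hyy h1 (by omega)
      (by omega)
    rcases hA (G.dist u x + 1) (by omega) u y x z hxy.symm hzy.symm h1 rfl hz with e | hxz
    · exact hcon y' (e ▸ hzy').symm hyy.symm hy'
    · have hzo : G.dist o z ≠ k - 1 := fun h => hcon z hxz.symm hzy (by omega)
      have t1 := hG.dist_triangle (u := o) (v := u) (w := z)
      have t2 := hG.dist_le_dist_add_one o hzy.symm
      obtain ⟨w, hwx, hwz, hw⟩ := hB (G.dist u x) (by omega) u x z hxz rfl (by omega) hux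
      have t3 := hG.dist_triangle (u := o) (v := u) (w := w)
      have t4 := hG.dist_le_dist_add_one o hwx.symm
      have hwo : G.dist o w + 1 = k := by omega
      have nwy : ¬ G.Adj w y := fun h => hcon w hwx h hwo
      have nxy' : ¬ G.Adj x y' := fun h => hcon y' h.symm hyy.symm hy'
      rcases hA k le_rfl o z w y' hwz.symm hzy' (by omega) hwo hy' with e | e
      · exact nwy (e ▸ hyy.symm)
      · exact (hbr.chord_of_four_cycle hG hxy hyy e.symm hwx (by rintro rfl; omega)
          (by rintro rfl; omega)).elim nxy' (fun h => nwy h.symm)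
  obtain ⟨p, p0, -, px, hp⟩ := hG.exists_geodesic_through (a := o) (u := o) (b := x)
    (m := 0) (n := k) (by simp) hx (by simp)
  obtain ⟨q, q0, -, qy, hq⟩ := hG.exists_geodesic_through (a := o) (u := o) (b := y)
    (m := 0) (n := k) (by simp) hy (by simp)
  have op : ∀ s ≤ k, G.dist o (p s) = s := fun s hs => by
    have := hp 0 s (by omega) hs; rw [p0] at this; omega
  have oq : ∀ s ≤ k, G.dist o (q s) = s := fun s hs => by
    have := hq 0 s (by omega) hs; rw [q0] at this; omega
  have xp : ∀ s ≤ k, G.dist (p s) x = k - s := fun s hs => by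
    have := hp s k hs le_rfl; rwa [px] at this
  have yq : ∀ s ≤ k, G.dist (q s) y = k - s := fun s hs => by
    have := hq s k hs le_rfl; rwa [qy] at this
  have hyy : G.Adj y (q (k - 1)) := by
    rw [adj_comm, ← dist_eq_one_iff_adj, yq _ (by omega)]; omega
  have hy' : G.dist o (q (k - 1)) + 1 = k := by rw [oq _ (by omega)]; omega
  have yp : ∀ s, 1 ≤ s → s ≤ k → G.dist (p s) y = k - s + 1 := fun s hs hsk => by
    rw [F1 (p s) (by rw [op s hsk, xp s hsk]; omega) (by rw [op s hsk]; omega), xp s hsk]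
  have xq : ∀ s, 1 ≤ s → s ≤ k → G.dist (q s) x = k - s + 1 := fun s hs hsk => by
    rw [F1y (q s) (by rw [oq s hsk, yq s hsk]; omega) (by rw [oq s hsk]; omega), yq s hsk]
  have F4 : ∀ s, 1 ≤ s → s < k → G.dist (p s) (q 1) = s + 1 := by
    intro s hs hsk
    have hq1 : G.Adj o (q 1) := dist_eq_one_iff_adj.1 (oq 1 (by omega))
    have h1 := xq 1 le_rfl (by omega)
    have h2 := hG.dist_triangle (u := q 1) (v := p s) (w := x)
    have h3 := hG.dist_le_dist_add_one (p s) hq1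
    have h4 := hG.dist_le_dist_add_one (p s) hq1.symm
    have h5 := op s hsk.le
    rw [xp s hsk.le, SimpleGraph.dist_comm (u := q 1) (v := p s)] at h2
    rw [SimpleGraph.dist_comm] at h5
    by_contra hne
    obtain ⟨z, hzo, hzq, hz⟩ := hB s hsk (p s) o (q 1) hq1 h5 (by omega) (by omega)
    have h6 := hG.dist_triangle (u := z) (v := p s) (w := x)
    have h7 := hG.dist_triangle (u := o) (v := z) (w := x)
    have h8 := dist_eq_one_iff_adj.2 hzo.symm
    rw [xp s hsk.le, SimpleGraph.dist_comm (u := z) (v := p s)] at h6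
    have h9 := F2 z (q (k - 1)) (by omega) (by omega) hyy hy'
    have h10 := hG.dist_le_dist_add_one (q (k - 1)) hzq
    rw [SimpleGraph.dist_comm (v := z), SimpleGraph.dist_comm (v := q 1),
      hq _ _ (by omega) (by omega)] at h10
    omega
  have main : ∀ s t, 1 ≤ s → s < k → 1 ≤ t → t < k →
      G.dist (p s) (q t) = min (s + t) (2 * k + 1 - (s + t)) := by
    intro s t hs hsk ht htk
    have up1 : ∀ i ≤ k, G.dist (p s) (q i) ≤ s + i := fun i hi => by
      have := hG.dist_triangle (u := p s) (v := o) (w := q i)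
      rw [oq i hi, SimpleGraph.dist_comm (u := p s) (v := o), op s hsk.le] at this
      exact this
    have up2 : ∀ i ≤ k, G.dist (p s) (q i) ≤ (k - s + 1) + (k - i) := fun i hi => by
      have := hG.dist_triangle (u := p s) (v := y) (w := q i)
      rw [yp s hs hsk.le, SimpleGraph.dist_comm (u := y), yq i hi] at this
      exact this
    have tri : ∀ i ≤ k, G.dist (p s) (q i) ≤ G.dist (p s) (q t) + ((i - t) + (t - i)) := by
      intro i hi
      have h1 := hG.dist_triangle (u := p s) (v := q t) (w := q i)
      rcases le_total t i with h | h
      · rw [hq _ _ h (by omega)] at h1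
        omega
      · rw [SimpleGraph.dist_comm (u := q t), hq _ _ h (by omega)] at h1
        omega
    have u1 := up1 t htk.le
    have u2 := up2 t htk.le
    rcases Nat.lt_or_ge s 2 with hs2 | hs2
    · obtain rfl : s = 1 := by omega
      have h1 := F2 (p 1) (q (k - 1)) (by rw [op 1 hsk.le, xp 1 hsk.le]; omega)
        (by rw [op 1 hsk.le]; omega) hyy hy'
      rw [xp 1 hsk.le] at h1
      have := tri (k - 1) (by omega)
      omega
    · have peak : ∀ i, 0 < i → i < k → G.dist (p s) (q i) = k → G.dist (p s) (q (i - 1)) < k →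
          G.dist (p s) (q (i + 1)) < k → False := by
        intro i hi hik h1 h2 h3
        have a1 : G.Adj (q i) (q (i - 1)) := by
          rw [adj_comm, ← dist_eq_one_iff_adj, hq _ _ (by omega) (by omega)]; omega
        have a2 : G.Adj (q i) (q (i + 1)) := by
          rw [← dist_eq_one_iff_adj, hq _ _ (by omega) (by omega)]; omega
        have l1 := hG.dist_le_dist_add_one (p s) a1
        have l2 := hG.dist_le_dist_add_one (p s) a2
        have h4 := hq (i - 1) (i + 1) (by omega) (by omega)
        rcases hA k le_rfl (p s) (q i) (q (i - 1)) (q (i + 1)) a1 a2 h1 (by omega) (by omega)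
          with e | e
        · rw [e, SimpleGraph.dist_self] at h4; omega
        · rw [dist_eq_one_iff_adj.2 e] at h4; omega
      rcases eq_or_lt_of_no_peak hs2 hsk up1 up2 peak with ⟨e1, e2⟩ | low
      · have h1 := tri (k - s) (by omega)
        have h2 := tri (k - s + 1) (by omega)
        clear up1 up2 tri peak
        omega
      · exfalso
        have h3 := F3 (p s) (q (k - 1)) (by rw [op s hsk.le, xp s hsk.le]; omega)
          (by rw [op s hsk.le]; omega) (by rw [xp s hsk.le]; omega) hyy hy'
        have := (dist_le_dist_succ_of_rise hG (c := p s) (q := fun i => q (k - i)) (n := k)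
          (fun i j hij hj => by
            rw [SimpleGraph.dist_comm, hq _ _ (by omega) (by omega)]; omega)
          (fun i _ => hA _ (low _ (by omega)).le _) (fun i _ => hB _ (low _ (by omega)) _)
          (by simp only [Nat.sub_zero, qy]; rw [h3, yp s hs hsk.le, xp s hsk.le]) (k - 1)
          (by omega)).1
        simp only [show k - (k - 1) = 1 by omega, show k - (k - 1 + 1) = 0 by omega, q0] at this
        rw [F4 s hs hsk, SimpleGraph.dist_comm, op s hsk.le] at this
        omega
  have := hbr.length_eq_three (n := 2 * k + 1) (by omega)
    (fun i => if i ≤ k then p i else q (2 * k + 1 - i)) (by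
      intro i j hij hj
      rcases le_or_gt j k with hjk | hjk
      · simp only [hjk, show i ≤ k by omega, if_true]
        rw [hp i j hij.le hjk]; omega
      · rcases le_or_gt i k with hik | hik
        · simp only [hik, not_le.2 hjk, if_true, if_false]
          rcases Nat.eq_zero_or_pos i with rfl | hi
          · rw [p0, oq _ (by omega)]; omega
          · rcases Nat.lt_or_ge i k with hik' | hik'
            · rcases Nat.lt_or_ge (k + 1) j with hjk' | hjk'
              · rw [main i _ hi hik' (by omega) (by omega)]; omega
              · obtain rfl : j = k + 1 := by omega
                rw [show 2 * k + 1 - (k + 1) = k by omega, qy, yp i hi hik]; omega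
            · obtain rfl : i = k := by omega
              rw [px, SimpleGraph.dist_comm, xq _ (by omega) (by omega)]; omega
        · simp only [not_le.2 hjk, not_le.2 hik, if_false]
          rw [SimpleGraph.dist_comm, hq _ _ (by omega) (by omega)]; omega)
  omega

theorem Bridged.parentsClique_and_commonParent (hG : G.Connected) (hbr : Bridged G) (k : ℕ) :
    (∀ c, ParentsClique G c k) ∧ ∀ c, CommonParent G c k := by
  induction k using Nat.strong_induction_on with
  | _ k ih =>
    have hA : ∀ c, ParentsClique G c k :=
      parentsClique_of_lt hG hbr (fun j hj => (ih j hj).1) (fun j hj => (ih j hj).2)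
    refine ⟨hA, commonParent_of_lt hG hbr (fun j hj => ?_) (fun j hj => (ih j hj).2)⟩
    rcases hj.lt_or_eq with h | rfl
    · exact (ih j h).1
    · exact hA

/-- Maps choosing for each vertex the (at most two) neighbours closer to the base point `o`,
with `o` mapped to itself. -/
structure ParentMaps (G : SimpleGraph V) (o : V) where
  fst : V → V
  snd : V → V
  dist_fst : ∀ v, G.dist o (fst v) = G.dist o v - 1
  dist_snd : ∀ v, G.dist o (snd v) = G.dist o v - 1
  adj_fst : ∀ v, v ≠ o → G.Adj v (fst v)
  adj_snd : ∀ v, v ≠ o → G.Adj v (snd v)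
  fst_eq_or_adj_snd : ∀ v, fst v = snd v ∨ G.Adj (fst v) (snd v)
  eq_of_adj : ∀ v w, G.Adj v w → G.dist o w + 1 = G.dist o v → w = fst v ∨ w = snd v

theorem nonempty_parentMaps (hG : G.Connected) (hK4 : K4Free G) {o : V}
    (hA : ∀ m, ParentsClique G o m) : Nonempty (ParentMaps G o) := by
  have key : ∀ v, ∃ p q : V, G.dist o p = G.dist o v - 1 ∧ G.dist o q = G.dist o v - 1 ∧
      (v ≠ o → G.Adj v p) ∧ (v ≠ o → G.Adj v q) ∧ (p = q ∨ G.Adj p q) ∧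
      ∀ w, G.Adj v w → G.dist o w + 1 = G.dist o v → w = p ∨ w = q := by
    intro v
    by_cases hv : v = o
    · exact ⟨o, o, by simp [hv], by simp [hv], by simp [hv], by simp [hv], .inl rfl,
        fun w _ h => by simp [hv] at h⟩
    · have hpos : 0 < G.dist o v := hG.pos_dist_of_ne (Ne.symm hv)
      obtain ⟨g, g0, -, gv, hg⟩ := hG.exists_geodesic_through (a := o) (u := o) (b := v)
        (m := 0) (n := G.dist o v) (by simp) rfl (by simp)
      have hp : G.Adj v (g (G.dist o v - 1)) := by
        have := hg (G.dist o v - 1) (G.dist o v) (by omega) le_rfl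
        rw [gv] at this
        rw [adj_comm, ← dist_eq_one_iff_adj, this]; omega
      have hpo : G.dist o (g (G.dist o v - 1)) = G.dist o v - 1 := by
        have := hg 0 (G.dist o v - 1) (by omega) (by omega)
        rwa [g0] at this
      generalize g (G.dist o v - 1) = p at hp hpo
      by_cases hq : ∃ q, q ≠ p ∧ G.Adj v q ∧ G.dist o q + 1 = G.dist o v
      · obtain ⟨q, hqp, hq, hqo⟩ := hq
        have hpq : G.Adj p q := (hA _ v p q hp hq rfl (by omega) hqo).resolve_left hqp.symm
        refine ⟨p, q, hpo, by omega, fun _ => hp, fun _ => hq, .inr hpq, fun w hw hwo => ?_⟩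
        by_contra! hcon
        have h1 := (hA _ v p w hp hw rfl (by omega) hwo).resolve_left hcon.1.symm
        have h2 := (hA _ v q w hq hw rfl (by omega) hwo).resolve_left hcon.2.symm
        exact hK4 ⟨v, p, q, w, hp, hq, hw, hpq, h1, h2⟩
      · push Not at hq
        exact ⟨p, p, hpo, hpo, fun _ => hp, fun _ => hp, .inl rfl, fun w hw hwo =>
          .inl (by_contra fun h => hq w h hw hwo)⟩
  choose p q h1 h2 h3 h4 h5 h6 using key
  exact ⟨p, q, h1, h2, h3, h4, h5, h6⟩

/-- `SphereChain G o m v w`: the vertex `w` can be reached from `v` by at most `m` steps inside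
the sphere about `o` containing `v`. -/
def SphereChain (G : SimpleGraph V) (o : V) : ℕ → V → V → Prop
  | 0, v, w => v = w
  | m + 1, v, w => ∃ u, SphereChain G o m v u ∧ G.dist o u = G.dist o w ∧ (u = w ∨ G.Adj u w)

theorem SphereChain.dist_eq {o : V} {m : ℕ} {v w : V} (h : SphereChain G o m v w) :
    G.dist o v = G.dist o w := by
  induction m generalizing w with
  | zero => rw [show v = w from h]
  | succ m ih =>
    obtain ⟨u, hu, huw, -⟩ := h
    exact (ih hu).trans huw

theorem SphereChain.cons {o : V} {m : ℕ} {a v w : V} (h : SphereChain G o m v w)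
    (hav : G.dist o a = G.dist o v) (ha : a = v ∨ G.Adj a v) : SphereChain G o (m + 1) a w := by
  induction m generalizing w with
  | zero =>
    obtain rfl : v = w := h
    exact ⟨a, rfl, hav, ha⟩
  | succ m ih =>
    obtain ⟨u, hu, h2, h3⟩ := h
    exact ⟨u, ih hu, h2, h3⟩

theorem SphereChain.exists_parents {o : V} (hA : ∀ m, ParentsClique G o m)
    (hB : ∀ m, CommonParent G o m) (π : ParentMaps G o) {m : ℕ} {v w : V}
    (h : SphereChain G o (m + 1) v w) (hv : v ≠ o) (hw : w ≠ o) (hG : G.Connected) :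
    ∃ e f, (e = π.fst v ∨ e = π.snd v) ∧ (f = π.fst w ∨ f = π.snd w) ∧
      SphereChain G o m e f := by
  have pos : ∀ {v}, v ≠ o → 0 < G.dist o v := fun h => hG.pos_dist_of_ne h.symm
  induction m generalizing w with
  | zero =>
    obtain ⟨u, hu, huw, h⟩ := h
    obtain rfl : v = u := hu
    rcases h with rfl | h
    · exact ⟨π.fst v, π.fst v, .inl rfl, .inl rfl, rfl⟩
    · obtain ⟨z, hzv, hzw, hz⟩ := hB _ v w h huw rfl (pos hw)
      exact ⟨z, z, π.eq_of_adj _ _ hzv.symm (by omega), π.eq_of_adj _ _ hzw.symm hz, rfl⟩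
  | succ m ih =>
    obtain ⟨u, hu, huw, h⟩ := h
    have huo : u ≠ o := by rintro rfl; have := pos hw; simp at huw; omega
    obtain ⟨e, f, he, hf, hef⟩ := ih hu huo
    rcases h with rfl | h
    · exact ⟨e, f, he, hf, f, hef, rfl, .inl rfl⟩
    · obtain ⟨z, hzu, hzw, hz⟩ := hB _ u w h huw rfl (pos hw)
      refine ⟨e, z, he, π.eq_of_adj _ _ hzw.symm hz, f, hef, ?_⟩
      have hfo : G.dist o f + 1 = G.dist o u ∧ G.Adj u f := by
        rcases hf with rfl | rfl
        · exact ⟨by rw [π.dist_fst]; have := pos huo; omega, π.adj_fst u huo⟩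
        · exact ⟨by rw [π.dist_snd]; have := pos huo; omega, π.adj_snd u huo⟩
      exact ⟨by omega, hA _ u f z hfo.2 hzu.symm rfl hfo.1 (by omega)⟩

/-- The probability that a lazy simple random walk started at `m` has not yet hit `0` at
time `j`. -/
noncomputable def survival : ℕ → ℕ → ℝ
  | 0, 0 => 0
  | 0, _ + 1 => 1
  | _ + 1, 0 => 0
  | j + 1, m + 1 => (survival j m + 2 * survival j (m + 1) + survival j (m + 2)) / 4

@[simp]
theorem survival_zero_right (j : ℕ) : survival j 0 = 0 := by
  cases j <;> rfl

theorem survival_succ_succ (j m : ℕ) : survival (j + 1) (m + 1) =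
    (survival j m + 2 * survival j (m + 1) + survival j (m + 2)) / 4 := rfl

theorem survival_nonneg (j m : ℕ) : 0 ≤ survival j m := by
  induction j generalizing m with
  | zero => cases m <;> simp [survival]
  | succ j ih =>
    cases m with
    | zero => simp
    | succ m =>
      rw [survival_succ_succ]
      linarith [ih m, ih (m + 1), ih (m + 2)]

theorem survival_le_one (j m : ℕ) : survival j m ≤ 1 := by
  induction j generalizing m with
  | zero => cases m <;> simp [survival]
  | succ j ih =>
    cases m with
    | zero => simp
    | succ m =>
      rw [survival_succ_succ]
      linarith [ih m, ih (m + 1), ih (m + 2)]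

theorem survival_succ_le (j m : ℕ) : survival (j + 1) m ≤ survival j m := by
  induction j generalizing m with
  | zero =>
    cases m with
    | zero => simp
    | succ m => exact survival_le_one 1 (m + 1)
  | succ j ih =>
    cases m with
    | zero => simp
    | succ m =>
      have h1 := survival_succ_succ (j + 1) m
      have h2 := survival_succ_succ j m
      linarith [ih m, ih (m + 1), ih (m + 2)]

open Filter Topology in
theorem tendsto_survival_one : Tendsto (fun j => survival j 1) atTop (𝓝 0) := by
  have lim : ∀ m, ∃ l, Tendsto (fun j => survival j m) atTop (𝓝 l) := fun m =>
    ⟨_, tendsto_atTop_ciInf (antitone_nat_of_succ_le fun j => survival_succ_le j m)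
      ⟨0, by rintro _ ⟨j, rfl⟩; exact survival_nonneg j m⟩⟩
  choose l hl using lim
  have h0 : l 0 = 0 := tendsto_nhds_unique (hl 0) (by simp)
  have hrec : ∀ m, l (m + 2) = 2 * l (m + 1) - l m := fun m => by
    have h1 := (hl (m + 1)).comp (tendsto_add_atTop_nat 1)
    have h2 := (((hl m).add ((hl (m + 1)).const_mul 2)).add (hl (m + 2))).div_const 4
    have := tendsto_nhds_unique h1 h2
    linarith
  have hlin : ∀ m : ℕ, l m = m * l 1 ∧ l (m + 1) = (m + 1) * l 1 := by
    intro m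
    induction m with
    | zero => simp [h0]
    | succ m ih =>
      push_cast
      refine ⟨ih.2, ?_⟩
      rw [hrec, ih.1, ih.2]
      ring
  have hle : ∀ m, l m ≤ 1 := fun m => le_of_tendsto' (hl m) fun j => survival_le_one j m
  have hge : 0 ≤ l 1 := ge_of_tendsto' (hl 1) fun j => survival_nonneg j 1
  have : l 1 = 0 := by
    by_contra hne
    have hpos : 0 < l 1 := lt_of_le_of_ne hge (Ne.symm hne)
    obtain ⟨m, hm⟩ := exists_nat_gt (1 / l 1)
    rw [div_lt_iff₀ hpos, ← (hlin m).1] at hm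
    linarith [hle m]
  exact this ▸ hl 1

namespace ParentMaps

variable {o : V} {E : Type*} [NormedAddCommGroup E] [NormedSpace ℝ E]

/-- The expected value of `δ` at the endpoint of the `j`-step random descent towards `o`. -/
noncomputable def average (π : ParentMaps G o) (δ : V → E) : ℕ → V → E
  | 0, v => δ v
  | j + 1, v => (2⁻¹ : ℝ) • (π.average δ j (π.fst v) + π.average δ j (π.snd v))

theorem norm_average_le (π : ParentMaps G o) {δ : V → E} (hδ : ∀ v, ‖δ v‖ ≤ 1) (j : ℕ) (v : V) :
    ‖π.average δ j v‖ ≤ 1 := by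
  induction j generalizing v with
  | zero => exact hδ v
  | succ j ih =>
    rw [average, norm_smul]
    have := norm_add_le (π.average δ j (π.fst v)) (π.average δ j (π.snd v))
    have h1 := ih (π.fst v)
    have h2 := ih (π.snd v)
    norm_num
    linarith

theorem norm_average_sub_le (π : ParentMaps G o) (hG : G.Connected)
    (hA : ∀ m, ParentsClique G o m) (hB : ∀ m, CommonParent G o m) {δ : V → E}
    (hδ : ∀ v, ‖δ v‖ ≤ 1) (j m : ℕ) {v w : V} (h : SphereChain G o m v w) :
    ‖π.average δ j v - π.average δ j w‖ ≤ 2 * survival j m := by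
  induction j generalizing m v w with
  | zero =>
    cases m with
    | zero => rw [show v = w from h]; simp
    | succ m =>
      have := norm_sub_le (δ v) (δ w)
      simp only [average, survival]
      linarith [hδ v, hδ w]
  | succ j ih =>
    cases m with
    | zero => rw [show v = w from h]; simp
    | succ m =>
      have trivial_case : v = w →
          ‖π.average δ (j + 1) v - π.average δ (j + 1) w‖ ≤ 2 * survival (j + 1) (m + 1) := by
        rintro rfl
        simpa using survival_nonneg (j + 1) (m + 1)
      by_cases hv : v = o
      · have := h.dist_eq
        rw [hv, SimpleGraph.dist_self] at this
        exact trivial_case (hv.trans (hG.dist_eq_zero_iff.1 this.symm))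
      by_cases hw : w = o
      · have := h.dist_eq
        rw [hw, SimpleGraph.dist_self] at this
        exact trivial_case ((hG.dist_eq_zero_iff.1 this).symm.trans hw.symm)
      obtain ⟨e, f, he, hf, hef⟩ := h.exists_parents hA hB π hv hw hG
      have key : ∀ a b : V, (a = e ∨ G.Adj a e) → G.dist o a = G.dist o e →
          (f = b ∨ G.Adj f b) → G.dist o f = G.dist o b →
          ‖(2⁻¹ : ℝ) • (π.average δ j e + π.average δ j a) -
            (2⁻¹ : ℝ) • (π.average δ j f + π.average δ j b)‖ ≤
              2 * survival (j + 1) (m + 1) := by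
        intro a b hae hao hfb hfo
        have h1 := ih m hef
        have h2 := ih (m + 1) (hef.cons hao hae)
        have hfb' : SphereChain G o (m + 1) e b := ⟨f, hef, hfo, hfb⟩
        have h3 := ih (m + 1) hfb'
        have h4 := ih (m + 2) (hfb'.cons hao hae)
        have hdec : (2⁻¹ : ℝ) • (π.average δ j e + π.average δ j a) -
            (2⁻¹ : ℝ) • (π.average δ j f + π.average δ j b) =
            (4⁻¹ : ℝ) • ((π.average δ j e - π.average δ j f) +
              (π.average δ j a - π.average δ j f) + (π.average δ j e - π.average δ j b) +
              (π.average δ j a - π.average δ j b)) := by module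
        rw [hdec, norm_smul, survival_succ_succ]
        have h5 := norm_add₄_le (a := π.average δ j e - π.average δ j f)
          (b := π.average δ j a - π.average δ j f) (c := π.average δ j e - π.average δ j b)
          (d := π.average δ j a - π.average δ j b)
        norm_num
        linarith
      have pv := π.fst_eq_or_adj_snd v
      have pw := π.fst_eq_or_adj_snd w
      have d1 := π.dist_fst v
      have d2 := π.dist_snd v
      have d3 := π.dist_fst w
      have d4 := π.dist_snd w
      have pv' : π.snd v = π.fst v ∨ G.Adj (π.snd v) (π.fst v) := by
        rwa [eq_comm, adj_comm]
      have pw' : π.snd w = π.fst w ∨ G.Adj (π.snd w) (π.fst w) := by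
        rwa [eq_comm, adj_comm]
      rw [average, average]
      rcases he with rfl | rfl <;> rcases hf with rfl | rfl
      · exact key _ _ pv' (by omega) pw (by omega)
      · rw [add_comm (π.average δ j (π.fst w))]
        exact key _ _ pv' (by omega) pw' (by omega)
      · rw [add_comm (π.average δ j (π.fst v))]
        exact key _ _ pv (by omega) pw (by omega)
      · rw [add_comm (π.average δ j (π.fst v)), add_comm (π.average δ j (π.fst w))]
        exact key _ _ pv (by omega) pw' (by omega)

theorem norm_average_succ_sub_le (π : ParentMaps G o) (hG : G.Connected)
    (hA : ∀ m, ParentsClique G o m) (hB : ∀ m, CommonParent G o m) {δ : V → E}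
    (hδ : ∀ v, ‖δ v‖ ≤ 1) (j : ℕ) {v w : V} (hvw : G.Adj v w)
    (h : G.dist o w + 1 = G.dist o v) :
    ‖π.average δ (j + 1) v - π.average δ j w‖ ≤ 2 * survival j 1 := by
  have d1 := π.dist_fst v
  have d2 := π.dist_snd v
  have hp := π.fst_eq_or_adj_snd v
  have key : SphereChain G o 1 (π.fst v) w ∧ SphereChain G o 1 (π.snd v) w := by
    rcases π.eq_of_adj v w hvw h with rfl | rfl
    · exact ⟨⟨_, rfl, rfl, .inl rfl⟩, ⟨_, rfl, by omega, by rwa [eq_comm, adj_comm]⟩⟩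
    · exact ⟨⟨_, rfl, by omega, hp⟩, ⟨_, rfl, rfl, .inl rfl⟩⟩
  have h1 := π.norm_average_sub_le hG hA hB hδ j 1 key.1
  have h2 := π.norm_average_sub_le hG hA hB hδ j 1 key.2
  have hdec : π.average δ (j + 1) v - π.average δ j w =
      (2⁻¹ : ℝ) • ((π.average δ j (π.fst v) - π.average δ j w) +
        (π.average δ j (π.snd v) - π.average δ j w)) := by
    rw [average]; module
  rw [hdec, norm_smul]
  have := norm_add_le (π.average δ j (π.fst v) - π.average δ j w)
    (π.average δ j (π.snd v) - π.average δ j w)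
  norm_num
  linarith

theorem norm_sum_average_sub_le (π : ParentMaps G o) (hG : G.Connected)
    (hA : ∀ m, ParentsClique G o m) (hB : ∀ m, CommonParent G o m) {δ : V → E}
    (hδ : ∀ v, ‖δ v‖ ≤ 1) (n : ℕ) {v w : V} (hvw : G.Adj v w) :
    ‖∑ j ∈ Finset.range n, π.average δ j v - ∑ j ∈ Finset.range n, π.average δ j w‖ ≤
      2 + 2 * ∑ j ∈ Finset.range n, survival j 1 := by
  have descent : ∀ {v w : V}, G.Adj v w → G.dist o w + 1 = G.dist o v →
      ‖∑ j ∈ Finset.range n, π.average δ j v - ∑ j ∈ Finset.range n, π.average δ j w‖ ≤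
        2 + 2 * ∑ j ∈ Finset.range n, survival j 1 := by
    intro v w hvw h
    have hsum : ∑ j ∈ Finset.range n, π.average δ j v - ∑ j ∈ Finset.range n, π.average δ j w =
        (π.average δ 0 v - π.average δ n v) +
          ∑ j ∈ Finset.range n, (π.average δ (j + 1) v - π.average δ j w) := by
      have h1 := Finset.sum_range_succ (fun j => π.average δ j v) n
      have h2 := Finset.sum_range_succ' (fun j => π.average δ j v) n
      rw [h1, ← eq_sub_iff_add_eq] at h2
      rw [h2, Finset.sum_sub_distrib]
      abel
    rw [hsum, Finset.mul_sum]
    refine (norm_add_le _ _).trans (add_le_add ?_ ?_)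
    · refine (norm_sub_le _ _).trans ?_
      linarith [π.norm_average_le hδ 0 v, π.norm_average_le hδ n v]
    · exact norm_sum_le_of_le _ fun j _ => π.norm_average_succ_sub_le hG hA hB hδ j hvw h
  have l1 := hG.dist_le_dist_add_one o hvw
  have l2 := hG.dist_le_dist_add_one o hvw.symm
  rcases Nat.lt_trichotomy (G.dist o v) (G.dist o w) with h | h | h
  · rw [norm_sub_rev]
    exact descent hvw.symm (by omega)
  · rw [← Finset.sum_sub_distrib, Finset.mul_sum]
    have hc : SphereChain G o 1 v w := ⟨v, rfl, h, .inr hvw⟩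
    have := norm_sum_le_of_le (Finset.range n) fun j _ =>
      π.norm_average_sub_le hG hA hB hδ j 1 hc
    linarith
  · exact descent hvw (by omega)

open scoped Classical in
/-- The number of `j`-step descents from `v` ending at a given vertex. -/
noncomputable def descents (π : ParentMaps G o) : ℕ → V → V → ℕ
  | 0, v => Pi.single v 1
  | j + 1, v => π.descents j (π.fst v) + π.descents j (π.snd v)

theorem finite_support_descents (π : ParentMaps G o) (j : ℕ) (v : V) :
    (Function.support (π.descents j v)).Finite := by
  classical
  induction j generalizing v with
  | zero => exact (Set.finite_singleton v).subset Pi.support_single_subset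
  | succ j ih => exact ((ih _).union (ih _)).subset (Function.support_add _ _)

theorem dist_le_of_descents_ne_zero (π : ParentMaps G o) (hG : G.Connected) (j : ℕ) (v w : V)
    (h : π.descents j v w ≠ 0) : G.dist v w ≤ j := by
  have step : ∀ v u, (v ≠ o → G.Adj v u) → G.dist o u = G.dist o v - 1 →
      G.dist v w ≤ G.dist u w + 1 := by
    intro v u hu hd
    by_cases hv : v = o
    · rw [hv, SimpleGraph.dist_self] at hd
      rw [hv, hG.dist_eq_zero_iff.1 hd]
      omega
    · rw [SimpleGraph.dist_comm (u := v), SimpleGraph.dist_comm (u := u)]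
      exact hG.dist_le_dist_add_one w (hu hv)
  induction j generalizing v with
  | zero =>
    by_cases hwv : w = v
    · simp [hwv]
    · simp [descents, hwv] at h
  | succ j ih =>
    by_cases h1 : π.descents j (π.fst v) w = 0
    · have h2 : π.descents j (π.snd v) w ≠ 0 := fun h2 => h (by simp [descents, h1, h2])
      have := step v _ (π.adj_snd v) (π.dist_snd v)
      have := ih _ h2
      omega
    · have := step v _ (π.adj_fst v) (π.dist_fst v)
      have := ih _ h1
      omega

theorem finsum_descents (π : ParentMaps G o) (j : ℕ) (v : V) :
    ∑ᶠ w, π.descents j v w = 2 ^ j := by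
  classical
  induction j generalizing v with
  | zero =>
    rw [finsum_eq_single _ v fun w hw => by simp [descents, hw]]
    simp [descents]
  | succ j ih =>
    simp only [descents, Pi.add_apply]
    rw [finsum_add_distrib (π.finite_support_descents j _) (π.finite_support_descents j _), ih, ih]
    ring

open scoped Classical in
theorem average_single_apply (π : ParentMaps G o) (j : ℕ) (v w : V) :
    π.average (fun v => (lp.single 1 v 1 : lp (fun _ : V => ℝ) 1)) j v w =
      π.descents j v w / 2 ^ j := by
  induction j generalizing v with
  | zero => simp [average, descents, Pi.single_apply]
  | succ j ih =>
    simp only [average, descents, lp.coeFn_smul, lp.coeFn_add, Pi.smul_apply, Pi.add_apply, ih]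
    push_cast
    rw [smul_eq_mul]
    field_simp
    ring

/-- The number of descents from `v` of length at most `n`, weighted by `2 ^ (n - length)`,
ending at a given vertex. -/
noncomputable def weight (π : ParentMaps G o) (n : ℕ) (v w : V) : ℕ :=
  ∑ j ∈ Finset.range (n + 1), 2 ^ (n - j) * π.descents j v w

theorem exists_descents_of_weight_ne_zero (π : ParentMaps G o) {n : ℕ} {v w : V}
    (h : π.weight n v w ≠ 0) : ∃ j ≤ n, π.descents j v w ≠ 0 := by
  obtain ⟨j, hj, hne⟩ := Finset.exists_ne_zero_of_sum_ne_zero h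
  exact ⟨j, Nat.lt_succ_iff.1 (Finset.mem_range.1 hj), right_ne_zero_of_mul hne⟩

theorem finite_support_weight (π : ParentMaps G o) (n : ℕ) (v : V) :
    (Function.support (π.weight n v)).Finite := by
  refine ((Set.finite_Iic n).biUnion fun j _ => π.finite_support_descents j v).subset ?_
  intro w hw
  obtain ⟨j, hj, h⟩ := π.exists_descents_of_weight_ne_zero hw
  exact Set.mem_biUnion (Set.mem_Iic.2 hj) h

theorem finsum_weight (π : ParentMaps G o) (n : ℕ) (v : V) :
    ∑ᶠ w, π.weight n v w = 2 ^ n * (n + 1) := by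
  have hfin : ∀ j ∈ Finset.range (n + 1),
      (Function.support fun w => 2 ^ (n - j) * π.descents j v w).Finite := fun j _ =>
    (π.finite_support_descents j v).subset fun w hw => right_ne_zero_of_mul hw
  simp only [weight]
  rw [finsum_sum_comm _ _ hfin]
  have : ∀ j ∈ Finset.range (n + 1), ∑ᶠ w, 2 ^ (n - j) * π.descents j v w = 2 ^ n := by
    intro j hj
    rw [← mul_finsum, finsum_descents, ← pow_add,
      Nat.sub_add_cancel (Nat.lt_succ_iff.1 (Finset.mem_range.1 hj))]
  rw [Finset.sum_congr rfl this]
  simp [mul_comm]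

open scoped Classical in
theorem weight_eq_average (π : ParentMaps G o) (n : ℕ) (v w : V) :
    (π.weight n v w : ℝ) = 2 ^ n * (∑ j ∈ Finset.range (n + 1),
      π.average (fun v => (lp.single 1 v 1 : lp (fun _ : V => ℝ) 1)) j v) w := by
  rw [weight, lp.coeFn_sum, Finset.sum_apply, Finset.mul_sum]
  push_cast
  refine Finset.sum_congr rfl fun j hj => ?_
  rw [average_single_apply,
    ← pow_sub_mul_pow (2 : ℝ) (Nat.lt_succ_iff.1 (Finset.mem_range.1 hj))]
  field_simp

theorem finsum_abs_weight_sub_le (π : ParentMaps G o) (hG : G.Connected)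
    (hA : ∀ m, ParentsClique G o m) (hB : ∀ m, CommonParent G o m) (n : ℕ) {v v' : V}
    (h : G.Adj v v') :
    ∑ᶠ w, |(π.weight n v w : ℝ) - π.weight n v' w| ≤
      2 ^ n * (2 + 2 * ∑ j ∈ Finset.range (n + 1), survival j 1) := by
  classical
  have hδ : ∀ v : V, ‖(lp.single 1 v 1 : lp (fun _ : V => ℝ) 1)‖ ≤ 1 := fun v => by
    rw [lp.norm_single one_pos]; simp
  have hfin : (Function.support fun w => |(π.weight n v w : ℝ) - π.weight n v' w|).Finite := by
    refine ((π.finite_support_weight n v).union (π.finite_support_weight n v')).subset ?_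
    intro w hw
    by_contra hcon
    simp only [Set.mem_union, Function.mem_support, not_or, not_not] at hcon
    simp [hcon] at hw
  have hle := π.norm_sum_average_sub_le hG hA hB hδ (n + 1) h
  rw [lp.norm_eq_tsum_rpow (by simp)] at hle
  simp only [ENNReal.toReal_one, Real.rpow_one, div_one, lp.coeFn_sub, Pi.sub_apply,
    Real.norm_eq_abs] at hle
  rw [← tsum_eq_finsum (L := .unconditional V) hfin]
  simp only [weight_eq_average, ← mul_sub, abs_mul, abs_pow, Nat.abs_ofNat]
  rw [tsum_mul_left]
  gcongr

end ParentMaps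

end

/-- Every connected `K₄`-free bridged graph satisfies Property A.
(Main Theorem: 2-dimensional systolic complexes satisfy Property A.) -/
theorem systolic_propertyA {V : Type*} (G : SimpleGraph V)
    (hconn : G.Connected) (hK4 : K4Free G) (hbr : Bridged G) :
    PropertyA G := by
  obtain ⟨o⟩ := hconn.nonempty
  have hA : ∀ m, ParentsClique G o m := fun m => (hbr.parentsClique_and_commonParent hconn m).1 o
  have hB : ∀ m, CommonParent G o m := fun m => (hbr.parentsClique_and_commonParent hconn m).2 o
  obtain ⟨π⟩ := nonempty_parentMaps hconn hK4 hA
  refine ⟨id, π.weight, π.finite_support_weight, fun n v h => ?_, fun n v w h => ?_,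
    fun ε hε => ?_⟩
  · have := π.finsum_weight n v
    simp [h] at this
  · obtain ⟨j, hj, hne⟩ := π.exists_descents_of_weight_ne_zero h
    exact (π.dist_le_of_descents_ne_zero hconn j v w hne).trans hj
  · have hlim : Filter.Tendsto (fun n : ℕ => 2 * (n : ℝ)⁻¹ +
        2 * ((n : ℝ)⁻¹ * ∑ j ∈ Finset.range n, survival j 1)) Filter.atTop (nhds 0) := by
      simpa using (tendsto_inv_atTop_nhds_zero_nat (𝕜 := ℝ)).const_mul 2 |>.add
        (tendsto_survival_one.cesaro.const_mul 2)
    obtain ⟨N, hN⟩ := Filter.eventually_atTop.1 (hlim.eventually_lt_const hε)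
    refine ⟨N, fun n hn v v' hvv' => ?_⟩
    have hden : ∑ᶠ w, (π.weight n v w : ℝ) = 2 ^ n * (n + 1) := by
      have := (Nat.castAddMonoidHom ℝ).map_finsum (π.finite_support_weight n v)
      simp only [Nat.coe_castAddMonoidHom] at this
      rw [← this, π.finsum_weight]
      push_cast
      rfl
    refine lt_of_le_of_lt ?_ (hN (n + 1) (by omega))
    rw [hden, div_le_iff₀ (by positivity)]
    refine (π.finsum_abs_weight_sub_le hconn hA hB n hvv').trans_eq ?_
    push_cast
    field_simp
end

section
/- Let G be a hereditary modular graph. If there exists a vertex ∗ of G such that for every vertex v the interval I(∗,v) is K_{2,3}-free, then G satisfies Property A. (Graph formulation of: a quadric complex admitting a basepoint with flat intervals satisfies Property A.) -/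
/-- A connected graph is modular if every triple of vertices has a median. -/
def Modular {W : Type*} (G : SimpleGraph W) : Prop :=
  G.Connected ∧ ∀ u v w : W, ∃ m : W,
    G.dist u m + G.dist m v = G.dist u v ∧
    G.dist u m + G.dist m w = G.dist u w ∧
    G.dist v m + G.dist m w = G.dist v w

/-- A connected graph is hereditary modular if every connected isometric subgraph
of it is modular. -/
def HereditaryModular {V : Type*} (G : SimpleGraph V) : Prop :=
  G.Connected ∧ ∀ H : G.Subgraph, H.Connected →
    (∀ x y : H.verts, H.coe.dist x y = G.dist x.1 y.1) → Modular H.coe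

/-- The interval `I(u,v)`: the set of vertices lying on geodesics from `u` to `v`. -/
def interval {V : Type*} (G : SimpleGraph V) (u v : V) : Set V :=
  {w | G.dist u w + G.dist w v = G.dist u v}

/-- A graph is `K_{2,3}`-free if there are no five distinct vertices
`a₀, a₁, b₀, b₁, b₂` with `aᵢ` adjacent to `bⱼ` for all `i`, `j`. -/
def K23Free {W : Type*} (G : SimpleGraph W) : Prop :=
  ¬ ∃ a₀ a₁ b₀ b₁ b₂ : W, a₀ ≠ a₁ ∧ b₀ ≠ b₁ ∧ b₀ ≠ b₂ ∧ b₁ ≠ b₂ ∧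
    G.Adj a₀ b₀ ∧ G.Adj a₀ b₁ ∧ G.Adj a₀ b₂ ∧
    G.Adj a₁ b₀ ∧ G.Adj a₁ b₁ ∧ G.Adj a₁ b₂

namespace SimpleGraph

variable {V : Type*} {G : SimpleGraph V} {b u v w x y z p : V}

/-- In a modular graph, the distances from a basepoint to adjacent vertices differ by one. -/
theorem _root_.Modular.dist_adj (hM : Modular G) (b : V) (h : G.Adj u v) :
    G.dist b u = G.dist b v + 1 ∨ G.dist b v = G.dist b u + 1 := by
  obtain ⟨m, h1, h2, h3⟩ := hM.2 u v b
  have huv := dist_eq_one_iff_adj.2 h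
  have e1 := G.dist_comm (u := u) (v := b)
  have e2 := G.dist_comm (u := v) (v := b)
  have e3 := G.dist_comm (u := m) (v := v)
  omega

theorem Connected.exists_adj_of_dist_eq_succ (hc : G.Connected) {n : ℕ}
    (h : G.dist u w = n + 1) : ∃ x, G.Adj u x ∧ G.dist x w = n := by
  obtain ⟨q, hq⟩ := hc.exists_walk_length_eq_dist u w
  cases q with
  | nil => simp at h
  | @cons _ x _ hux q =>
    refine ⟨x, hux, ?_⟩
    have h1 : G.dist x w ≤ q.length := dist_le q
    have h2 := hc.dist_triangle (u := u) (v := x) (w := w)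
    have h3 := dist_eq_one_iff_adj.2 hux
    simp only [Walk.length_cons] at hq
    omega

/-- `x` is a parent of `w` if it is a neighbour of `w` closer to the basepoint `b`. -/
def IsParent (G : SimpleGraph V) (b w x : V) : Prop :=
  G.Adj w x ∧ G.dist b w = G.dist b x + 1

theorem mem_interval : w ∈ interval G u v ↔ G.dist u w + G.dist w v = G.dist u v := Iff.rfl

theorem IsParent.mem_interval (h : G.IsParent b w x) : x ∈ interval G b w := by
  have := dist_eq_one_iff_adj.2 h.1.symm
  have := h.2
  rw [SimpleGraph.mem_interval]
  omega

theorem IsParent.dist_of_mem (hc : G.Connected) (h : G.IsParent b v x)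
    (hw : w ∈ interval G b x) : w ∈ interval G b v ∧ G.dist v w = G.dist x w + 1 := by
  rw [SimpleGraph.mem_interval] at *
  have h1 := dist_eq_one_iff_adj.2 h.1
  have h2 := h.2
  have h3 := hc.dist_triangle (u := v) (v := x) (w := w)
  have h4 := hc.dist_triangle (u := b) (v := w) (w := v)
  have e1 := G.dist_comm (u := v) (v := w)
  have e2 := G.dist_comm (u := x) (v := w)
  omega

theorem IsParent.notMem_interval (h : G.IsParent b v x) : v ∉ interval G b x := by
  have := h.2
  rw [SimpleGraph.mem_interval]
  omega

theorem Connected.exists_isParent_of_mem_interval (hc : G.Connected) (hw : w ∈ interval G b v)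
    (hne : w ≠ v) : ∃ x, G.IsParent b v x ∧ w ∈ interval G b x := by
  rw [SimpleGraph.mem_interval] at hw
  have hpos := hc.pos_dist_of_ne hne.symm
  obtain ⟨n, hn⟩ := Nat.exists_eq_succ_of_ne_zero hpos.ne'
  obtain ⟨x, hvx, hx⟩ := hc.exists_adj_of_dist_eq_succ hn
  refine ⟨x, ?_⟩
  have h1 := dist_eq_one_iff_adj.2 hvx
  have h3 := hc.dist_triangle (u := b) (v := x) (w := v)
  have h4 := hc.dist_triangle (u := b) (v := w) (w := x)
  have e1 := G.dist_comm (u := v) (v := w)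
  have e2 := G.dist_comm (u := x) (v := w)
  have e3 := G.dist_comm (u := x) (v := v)
  rw [SimpleGraph.mem_interval]
  refine ⟨⟨hvx, ?_⟩, ?_⟩ <;> omega

theorem Connected.exists_isParent (hc : G.Connected) (hne : b ≠ v) : ∃ x, G.IsParent b v x := by
  obtain ⟨x, hx, -⟩ := hc.exists_isParent_of_mem_interval (w := b) (b := b) (v := v)
    (by simp [SimpleGraph.mem_interval]) hne
  exact ⟨x, hx⟩

theorem Connected.interval_self (hc : G.Connected) (b : V) : interval G b b = {b} := by
  ext w
  rw [SimpleGraph.mem_interval, dist_self, Nat.add_eq_zero_iff, hc.dist_eq_zero_iff,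
    hc.dist_eq_zero_iff, Set.mem_singleton_iff]
  exact ⟨fun h => h.2, fun h => ⟨h.symm, h⟩⟩

/-- The quadrangle condition, in the form adapted to intervals. -/
theorem _root_.Modular.exists_common_parent (hM : Modular G) (hx : G.IsParent b v x)
    (hy : G.IsParent b v y) (hxy : x ≠ y) (hwx : w ∈ interval G b x)
    (hwy : w ∈ interval G b y) :
    ∃ p, G.IsParent b x p ∧ G.IsParent b y p ∧ w ∈ interval G b p := by
  have hc := hM.1
  obtain ⟨p, h1, h2, h3⟩ := hM.2 x y w
  rw [SimpleGraph.mem_interval] at hwx hwy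
  have hlx := hx.2
  have hly := hy.2
  have hne : G.dist x y ≠ 1 := by
    rw [Ne, dist_eq_one_iff_adj]
    intro h
    have := hM.dist_adj b h
    omega
  have hpos := hc.pos_dist_of_ne hxy
  have t1 := hc.dist_triangle (u := x) (v := v) (w := y)
  have t2 := dist_eq_one_iff_adj.2 hx.1.symm
  have t3 := dist_eq_one_iff_adj.2 hy.1
  have e1 := G.dist_comm (u := x) (v := w)
  have e2 := G.dist_comm (u := y) (v := w)
  have e3 := G.dist_comm (u := p) (v := w)
  have e4 := G.dist_comm (u := p) (v := y)
  have e5 := G.dist_comm (u := p) (v := x)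
  have t4 := hc.dist_triangle (u := b) (v := w) (w := p)
  have t5 := hc.dist_triangle (u := b) (v := p) (w := x)
  have a1 : G.dist x p = 1 := by omega
  have a2 : G.dist y p = 1 := by omega
  refine ⟨p, ⟨dist_eq_one_iff_adj.1 a1, ?_⟩, ⟨dist_eq_one_iff_adj.1 a2, ?_⟩, ?_⟩
  · omega
  · omega
  · rw [SimpleGraph.mem_interval]
    omega

theorem base_mem_interval (b v : V) : b ∈ interval G b v := by
  simp [SimpleGraph.mem_interval]

theorem right_mem_interval (b v : V) : v ∈ interval G b v := by
  simp [SimpleGraph.mem_interval]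

/-- In a `K_{2,3}`-free interval, two parents of a vertex have at most one common parent. -/
theorem common_parent_unique (hc : G.Connected) (hK : K23Free (G.induce (interval G b v)))
    (hx : G.IsParent b v x) (hy : G.IsParent b v y) (hxy : x ≠ y)
    (hxp : G.IsParent b x p) (hyp : G.IsParent b y p)
    (hxq : G.IsParent b x z) (hyq : G.IsParent b y z) : p = z := by
  by_contra hpz
  have h1 := hx.2
  have h2 := hxp.2
  have h3 := hxq.2
  have hne : ∀ {q}, G.IsParent b x q → v ≠ q := by
    rintro q hq rfl
    have := hq.2
    omega
  refine hK ⟨⟨x, hx.mem_interval⟩, ⟨y, hy.mem_interval⟩, ⟨v, right_mem_interval b v⟩,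
    ⟨p, (hx.dist_of_mem hc hxp.mem_interval).1⟩, ⟨z, (hx.dist_of_mem hc hxq.mem_interval).1⟩,
    ?_, ?_, ?_, ?_, hx.1.symm, hxp.1, hxq.1, hy.1.symm, hyp.1, hyq.1⟩
  · simpa using hxy
  · simpa using hne hxp
  · simpa using hne hxq
  · simpa using hpz

theorem _root_.HereditaryModular.modular (hG : HereditaryModular G) : Modular G := by
  have hc : (⊤ : G.Subgraph).Connected :=
    ⟨Subgraph.topIso.symm.connected_iff.1 hG.1⟩
  have hd : ∀ x y : (⊤ : G.Subgraph).verts,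
      (⊤ : G.Subgraph).coe.dist x y = G.dist x.1 y.1 := by
    intro x y
    apply le_antisymm
    · obtain ⟨q, hq⟩ := hG.1.exists_walk_length_eq_dist x.1 y.1
      rw [← hq, ← Walk.length_map Subgraph.topIso.symm.toHom q]
      exact dist_le _
    · obtain ⟨q, hq⟩ := hc.coe.exists_walk_length_eq_dist x y
      rw [← hq, ← Walk.length_map (⊤ : G.Subgraph).hom q]
      exact dist_le _
  have hM := hG.2 ⊤ hc hd
  refine ⟨hG.1, fun u v w => ?_⟩
  obtain ⟨m, hm⟩ := hM.2 ⟨u, trivial⟩ ⟨v, trivial⟩ ⟨w, trivial⟩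
  simp only [hd] at hm
  exact ⟨m.1, hm⟩

/-- A hexagon `a 0, c 2, a 1, c 0, a 2, c 1` on two consecutive spheres around `b` has a chord
making one of the `c i` adjacent to all of the `a j`. -/
theorem _root_.HereditaryModular.exists_adj_of_hexagon (hG : HereditaryModular G)
    {a c : Fin 3 → V} (ha : Function.Injective a) (hac : ∀ i j, i ≠ j → G.Adj (a i) (c j)) {n : ℕ}
    (hla : ∀ i, G.dist b (a i) = n + 1) (hlc : ∀ i, G.dist b (c i) = n) :
    ∃ j, ∀ i, G.Adj (a i) (c j) := by
  have hM := hG.modular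
  have third : ∀ i j : Fin 3, ∃ k, i ≠ k ∧ j ≠ k := by decide
  set S : Set V := Set.range a ∪ Set.range c with hS
  set H : G.Subgraph := (⊤ : G.Subgraph).induce S with hH
  have hadj : ∀ x y : H.verts, G.Adj x.1 y.1 → H.coe.Adj x y := by
    intro x y h
    exact ⟨x.2, y.2, h⟩
  have hSa : ∀ i, a i ∈ H.verts := fun i => Or.inl ⟨i, rfl⟩
  have hSc : ∀ i, c i ∈ H.verts := fun i => Or.inr ⟨i, rfl⟩
  have hsame : ∀ x y : V, x ≠ y → G.dist b x = G.dist b y → 2 ≤ G.dist x y := by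
    intro x y hxy h
    have h1 := hM.1.pos_dist_of_ne hxy
    have h2 : G.dist x y ≠ 1 := by
      rw [Ne, dist_eq_one_iff_adj]
      intro h'
      have := hM.dist_adj b h'
      omega
    omega
  have hodd : ∀ x y : V, ¬ G.Adj x y → G.dist b x = G.dist b y + 1 → 3 ≤ G.dist x y := by
    intro x y hxy h
    have h0 : G.dist x y ≠ 0 := by
      rw [Ne, hM.1.dist_eq_zero_iff]
      rintro rfl
      omega
    have h1 : G.dist x y ≠ 1 := by rwa [Ne, dist_eq_one_iff_adj]
    have h2 : G.dist x y ≠ 2 := by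
      intro h2
      obtain ⟨z, hz, hzy⟩ := hM.1.exists_adj_of_dist_eq_succ h2
      have h3 := hM.dist_adj b hz
      have h4 := hM.dist_adj b (dist_eq_one_iff_adj.1 hzy)
      omega
    omega
  have walk_ac : ∀ i j, ∃ q : H.coe.Walk ⟨a i, hSa i⟩ ⟨c j, hSc j⟩,
      q.length ≤ G.dist (a i) (c j) := by
    intro i j
    by_cases h : G.Adj (a i) (c j)
    · exact ⟨(hadj ⟨a i, hSa i⟩ ⟨c j, hSc j⟩ h).toWalk, by simp [dist_eq_one_iff_adj.2 h]⟩
    · have h3 := hodd _ _ h (by rw [hla, hlc])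
      obtain ⟨k, hk, -⟩ := third i i
      obtain ⟨l, hl, hl'⟩ := third k j
      refine ⟨.cons (hadj ⟨a i, hSa i⟩ ⟨c k, hSc k⟩ (hac i k hk))
        (.cons (hadj ⟨c k, hSc k⟩ ⟨a l, hSa l⟩ (hac l k hl.symm).symm)
        (.cons (hadj ⟨a l, hSa l⟩ ⟨c j, hSc j⟩ (hac l j hl'.symm)) .nil)), ?_⟩
      simpa using h3
  have walk : ∀ x y : H.verts, ∃ q : H.coe.Walk x y, q.length ≤ G.dist x.1 y.1 := by
    rintro ⟨_, ⟨i, rfl⟩ | ⟨i, rfl⟩⟩ ⟨_, ⟨j, rfl⟩ | ⟨j, rfl⟩⟩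
    · by_cases h : a i = a j
      · have hij := ha h
        subst hij
        exact ⟨.nil, by simp⟩
      · obtain ⟨k, hk, hk'⟩ := third i j
        refine ⟨.cons (hadj ⟨a i, hSa i⟩ ⟨c k, hSc k⟩ (hac i k hk))
          (.cons (hadj ⟨c k, hSc k⟩ ⟨a j, hSa j⟩ (hac j k hk').symm) .nil), ?_⟩
        simpa using hsame _ _ h (by rw [hla, hla])
    · exact walk_ac i j
    · obtain ⟨q, hq⟩ := walk_ac j i
      refine ⟨q.reverse, ?_⟩
      rw [Walk.length_reverse, dist_comm]
      exact hq
    · by_cases h : c i = c j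
      · have hij : (⟨c i, hSc i⟩ : H.verts) = ⟨c j, hSc j⟩ := Subtype.ext h
        exact ⟨Walk.nil.copy rfl hij, by simp⟩
      · obtain ⟨k, hk, hk'⟩ := third i j
        refine ⟨.cons (hadj ⟨c i, hSc i⟩ ⟨a k, hSa k⟩ (hac k i hk.symm).symm)
          (.cons (hadj ⟨a k, hSa k⟩ ⟨c j, hSc j⟩ (hac k j hk'.symm)) .nil), ?_⟩
        simpa using hsame _ _ h (by rw [hlc, hlc])
  have hconn : H.coe.Connected :=
    { preconnected := fun x y => ⟨(walk x y).choose⟩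
      nonempty := ⟨⟨a 0, hSa 0⟩⟩ }
  have hd : ∀ x y : H.verts, H.coe.dist x y = G.dist x.1 y.1 := by
    intro x y
    apply le_antisymm
    · obtain ⟨q, hq⟩ := walk x y
      exact (dist_le q).trans hq
    · obtain ⟨q, hq⟩ := hconn.exists_walk_length_eq_dist x y
      rw [← hq, ← Walk.length_map H.hom q]
      exact dist_le _
  obtain ⟨⟨m, hm⟩, h1, h2, h3⟩ :=
    (hG.2 H ⟨hconn⟩ hd).2 ⟨a 0, hSa 0⟩ ⟨a 1, hSa 1⟩ ⟨a 2, hSa 2⟩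
  simp only [hd] at h1 h2 h3
  have hdist : ∀ i j, i ≠ j → G.dist (a i) (a j) = 2 := by
    intro i j hij
    apply le_antisymm
    · obtain ⟨k, hk, hk'⟩ := third i j
      have h4 := hM.1.dist_triangle (u := a i) (v := c k) (w := a j)
      rw [dist_eq_one_iff_adj.2 (hac i k hk),
        dist_eq_one_iff_adj.2 (hac j k hk').symm] at h4
      exact h4
    · exact hsame _ _ (ha.ne hij) (by rw [hla, hla])
  rw [hdist _ _ (by decide), G.dist_comm (u := m)] at h1 h2 h3
  have hma : ∀ i, G.Adj (a i) m := by
    intro i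
    rw [← dist_eq_one_iff_adj]
    fin_cases i <;> simp only [Fin.zero_eta, Fin.mk_one, Fin.reduceFinMk] <;> omega
  obtain ⟨i, rfl⟩ | ⟨j, rfl⟩ := hm
  · exact absurd (hma i) (G.loopless.irrefl _)
  · exact ⟨j, hma⟩

/-- If all intervals at `b` are `K_{2,3}`-free, then a vertex has at most two parents. -/
theorem _root_.HereditaryModular.parents_le_two (hG : HereditaryModular G)
    (hK : K23Free (G.induce (interval G b w))) (hx : G.IsParent b w x)
    (hy : G.IsParent b w y) (hz : G.IsParent b w z) (hxy : x ≠ y) : z = x ∨ z = y := by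
  by_contra! hne
  obtain ⟨hzx, hzy⟩ := hne
  have hM := hG.modular
  have hc := hM.1
  have common : ∀ {s t}, G.IsParent b w s → G.IsParent b w t → s ≠ t →
      ∃ p, G.IsParent b s p ∧ G.IsParent b t p := by
    intro s t hs ht hst
    obtain ⟨p, h1, h2, -⟩ := hM.exists_common_parent hs ht hst
      (base_mem_interval b s) (base_mem_interval b t)
    exact ⟨p, h1, h2⟩
  obtain ⟨p, hxp, hyp⟩ := common hx hy hxy
  obtain ⟨q, hyq, hzq⟩ := common hy hz hzy.symm
  obtain ⟨r, hxr, hzr⟩ := common hx hz hzx.symm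
  have lx := hx.2
  have ly := hy.2
  have lz := hz.2
  have lp := hxp.2
  have lq := hyq.2
  have lr := hxr.2
  have key := hG.exists_adj_of_hexagon (b := b) (a := ![x, y, z]) (c := ![q, r, p])
    (n := G.dist b p) ?_ ?_ ?_ ?_
  · obtain ⟨j, hj⟩ := key
    have hjl : G.dist b (![q, r, p] j) = G.dist b p := by
      fin_cases j <;> simp <;> omega
    generalize ![q, r, p] j = m at hj hjl
    have hmx : G.Adj x m := hj 0
    have hmy : G.Adj y m := hj 1
    have hmz : G.Adj z m := hj 2
    refine hK ⟨⟨w, right_mem_interval b w⟩,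
      ⟨m, (hx.dist_of_mem hc (IsParent.mem_interval ⟨hmx, by omega⟩)).1⟩,
      ⟨x, hx.mem_interval⟩, ⟨y, hy.mem_interval⟩, ⟨z, hz.mem_interval⟩,
      ?_, ?_, ?_, ?_, hx.1, hy.1, hz.1, hmx.symm, hmy.symm, hmz.symm⟩
    · rw [Ne, Subtype.mk.injEq]
      rintro rfl
      omega
    · simpa using hxy
    · simpa using hzx.symm
    · simpa using hzy.symm
  · intro i j hij
    fin_cases i <;> fin_cases j <;> simp_all
  · intro i j hij
    fin_cases i <;> fin_cases j <;>
      first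
      | exact absurd rfl hij
      | exact hxp.1
      | exact hyp.1
      | exact hyq.1
      | exact hzq.1
      | exact hxr.1
      | exact hzr.1
  · intro i
    fin_cases i <;> simp <;> omega
  · intro i
    fin_cases i <;> simp <;> omega

/-- Either `v` is the basepoint, or it has a unique parent, or it has exactly two parents. -/
theorem _root_.HereditaryModular.parents_cases (hG : HereditaryModular G)
    (hK : K23Free (G.induce (interval G b v))) :
    v = b ∨ (v ≠ b ∧ ∃ x, G.IsParent b v x ∧ ∀ z, G.IsParent b v z → z = x) ∨
      (v ≠ b ∧ ∃ x y, x ≠ y ∧ G.IsParent b v x ∧ G.IsParent b v y ∧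
        ∀ z, G.IsParent b v z → z = x ∨ z = y) := by
  by_cases hv : v = b
  · exact Or.inl hv
  obtain ⟨x, hx⟩ := hG.1.exists_isParent (Ne.symm hv)
  by_cases h : ∀ z, G.IsParent b v z → z = x
  · exact Or.inr (Or.inl ⟨hv, x, hx, h⟩)
  · push Not at h
    obtain ⟨y, hy, hyx⟩ := h
    exact Or.inr (Or.inr ⟨hv, x, y, hyx.symm, hx, hy,
      fun z hz => hG.parents_le_two hK hx hy hz hyx.symm⟩)

theorem _root_.HereditaryModular.finite_interval (hG : HereditaryModular G)
    (hflat : ∀ v, K23Free (G.induce (interval G b v))) (v : V) :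
    (interval G b v).Finite := by
  induction hn : G.dist b v using Nat.strong_induction_on generalizing v with
  | _ n ih =>
    subst hn
    have ih' : ∀ x, G.IsParent b v x → (interval G b x).Finite :=
      fun x hx => ih _ (by have := hx.2; omega) x rfl
    have hpar : {x | G.IsParent b v x}.Finite := by
      obtain rfl | ⟨-, x, -, hx⟩ | ⟨-, x, y, -, -, -, hxy⟩ := hG.parents_cases (hflat v)
      · convert Set.finite_empty
        ext x
        simp [IsParent]
      · exact (Set.finite_singleton x).subset fun z hz => hx z hz
      · exact (Set.toFinite {x, y}).subset fun z hz => hxy z hz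
    refine ((Set.finite_singleton v).union (hpar.biUnion ih')).subset fun w hw => ?_
    by_cases hwv : w = v
    · exact Or.inl hwv
    · obtain ⟨x, hx, hwx⟩ := hG.1.exists_isParent_of_mem_interval hw hwv
      exact Or.inr (Set.mem_biUnion hx hwx)

open Classical in
/-- The weight of `w`, depending on the number of parents of `w` and a parameter `m`. -/
noncomputable def parentWeight (G : SimpleGraph V) (b w : V) (m : ℕ) : ℕ :=
  if w = b then m.choose 2
  else if ∃! x, G.IsParent b w x then m - 1
  else if 2 ≤ m then 1 else 0

theorem parentWeight_mono (G : SimpleGraph V) (b w : V) : Monotone (parentWeight G b w) := by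
  intro m n hmn
  unfold parentWeight
  split_ifs
  · exact Nat.choose_le_choose 2 hmn
  · omega
  · exact le_rfl
  · omega
  · omega
  · omega

theorem parentWeight_of_lt_two {m : ℕ} (hm : m < 2) : parentWeight G b w m = 0 := by
  unfold parentWeight
  split_ifs
  · exact Nat.choose_eq_zero_of_lt hm
  · omega
  · omega
  · rfl

open Classical in
/-- The weight functions on the interval from `b` to `v` witnessing Property A. -/
noncomputable def intervalWeight (G : SimpleGraph V) (b : V) (n : ℕ) (v w : V) : ℕ :=
  if w ∈ interval G b v then parentWeight G b w (n - G.dist v w) else 0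

theorem intervalWeight_of_mem {n : ℕ} (h : w ∈ interval G b v) :
    intervalWeight G b n v w = parentWeight G b w (n - G.dist v w) := if_pos h

theorem intervalWeight_of_notMem {n : ℕ} (h : w ∉ interval G b v) :
    intervalWeight G b n v w = 0 := if_neg h

theorem _root_.HereditaryModular.finite_support_intervalWeight (hG : HereditaryModular G)
    (hflat : ∀ v, K23Free (G.induce (interval G b v))) (n : ℕ) (v : V) :
    (Function.support (intervalWeight G b n v)).Finite := by
  refine (hG.finite_interval hflat v).subset fun w hw => ?_
  by_contra h
  exact hw (intervalWeight_of_notMem h)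

theorem IsParent.intervalWeight_succ (hc : G.Connected) (hx : G.IsParent b v x)
    (hw : w ∈ interval G b x) (n : ℕ) :
    intervalWeight G b (n + 1) v w = intervalWeight G b n x w := by
  obtain ⟨h1, h2⟩ := hx.dist_of_mem hc hw
  rw [intervalWeight_of_mem h1, intervalWeight_of_mem hw, h2, Nat.add_sub_add_right]

theorem finsum_pi_single (v : V) (k : ℕ) [DecidableEq V] :
    ∑ᶠ w, (Pi.single v k : V → ℕ) w = k := by
  rw [finsum_eq_single _ v (fun w hw => Pi.single_eq_of_ne hw _), Pi.single_eq_same]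

/-- The total mass of `intervalWeight G b n v` does not depend on `v`. -/
theorem _root_.HereditaryModular.finsum_intervalWeight (hG : HereditaryModular G)
    (hflat : ∀ v, K23Free (G.induce (interval G b v))) (n : ℕ) (v : V) :
    ∑ᶠ w, intervalWeight G b n v w = n.choose 2 := by
  classical
  have hM := hG.modular
  have hc := hM.1
  have hfin := hG.finite_support_intervalWeight hflat
  induction hk : G.dist b v using Nat.strong_induction_on generalizing n v with
  | _ k ih =>
    subst hk
    have hsingle : ∀ k : ℕ, (Function.support (Pi.single v k : V → ℕ)).Finite := fun k =>
      (Set.finite_singleton v).subset Pi.support_single_subset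
    have hself : ∀ k, intervalWeight G b k v v = parentWeight G b v k := fun k => by
      simp [intervalWeight_of_mem (right_mem_interval b v)]
    obtain hn | ⟨n, rfl⟩ : n < 2 ∨ ∃ m, n = m + 2 :=
      (lt_or_ge n 2).imp id fun h => ⟨n - 2, by omega⟩
    · rw [Nat.choose_eq_zero_of_lt hn]
      refine finsum_eq_zero_of_forall_eq_zero fun w => ?_
      by_cases hw : w ∈ interval G b v
      · rw [intervalWeight_of_mem hw, parentWeight_of_lt_two (by omega)]
      · exact intervalWeight_of_notMem hw
    have c1 : (n + 2).choose 2 = (n + 1) + (n + 1).choose 2 := by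
      rw [Nat.choose_succ_succ' (n + 1) 1, Nat.choose_one_right]
    have c2 : (n + 1).choose 2 = n + n.choose 2 := by
      rw [Nat.choose_succ_succ' n 1, Nat.choose_one_right]
    obtain rfl | ⟨hvb, x, hx, huniq⟩ | ⟨hvb, x, y, hxy, hx, hy, htwo⟩ :=
      hG.parents_cases (hflat v)
    · rw [finsum_eq_single _ v, hself, parentWeight, if_pos rfl]
      intro w hw
      apply intervalWeight_of_notMem
      rwa [hc.interval_self]
    · have hpw : parentWeight G b v (n + 2) = n + 1 := by
        rw [parentWeight, if_neg hvb, if_pos ⟨x, hx, huniq⟩]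
        omega
      have hpt : ∀ w, intervalWeight G b (n + 2) v w =
          (Pi.single v (n + 1) : V → ℕ) w + intervalWeight G b (n + 1) x w := by
        intro w
        by_cases hwv : w = v
        · subst hwv
          rw [hself, hpw, Pi.single_eq_same, intervalWeight_of_notMem hx.notMem_interval]
        rw [Pi.single_eq_of_ne hwv, zero_add]
        by_cases hw : w ∈ interval G b x
        · exact hx.intervalWeight_succ hc hw _
        · rw [intervalWeight_of_notMem hw, intervalWeight_of_notMem]
          intro hw'
          obtain ⟨z, hz, hwz⟩ := hc.exists_isParent_of_mem_interval hw' hwv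
          exact hw (huniq z hz ▸ hwz)
      rw [finsum_congr hpt, finsum_add_distrib (hsingle _) (hfin _ _), finsum_pi_single,
        ih _ (by have := hx.2; omega) _ x rfl, c1]
    · have hpw : parentWeight G b v (n + 2) = 1 := by
        rw [parentWeight, if_neg hvb, if_neg, if_pos (by omega)]
        exact fun h => hxy (h.unique hx hy)
      obtain ⟨p, hxp, hyp, -⟩ := hM.exists_common_parent hx hy hxy
        (base_mem_interval b x) (base_mem_interval b y)
      have hpt : ∀ w, intervalWeight G b (n + 2) v w + intervalWeight G b n p w =
          ((Pi.single v 1 : V → ℕ) w + intervalWeight G b (n + 1) x w) +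
            intervalWeight G b (n + 1) y w := by
        intro w
        by_cases hwv : w = v
        · subst hwv
          have hwp : w ∉ interval G b p := fun h =>
            hx.notMem_interval (hxp.dist_of_mem hc h).1
          rw [hself, hpw, Pi.single_eq_same, intervalWeight_of_notMem hx.notMem_interval,
            intervalWeight_of_notMem hy.notMem_interval, intervalWeight_of_notMem hwp]
        rw [Pi.single_eq_of_ne hwv, zero_add]
        by_cases hwx : w ∈ interval G b x <;> by_cases hwy : w ∈ interval G b y
        · obtain ⟨q, hxq, hyq, hwq⟩ := hM.exists_common_parent hx hy hxy hwx hwy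
          obtain rfl := common_parent_unique hc (hflat v) hx hy hxy hxp hyp hxq hyq
          rw [hx.intervalWeight_succ hc hwx, hyp.intervalWeight_succ hc hwq]
        · rw [hx.intervalWeight_succ hc hwx, intervalWeight_of_notMem hwy,
            intervalWeight_of_notMem fun h => hwy (hyp.dist_of_mem hc h).1]
        · rw [hy.intervalWeight_succ hc hwy, intervalWeight_of_notMem hwx,
            intervalWeight_of_notMem fun h => hwx (hxp.dist_of_mem hc h).1, add_comm]
        · rw [intervalWeight_of_notMem hwx, intervalWeight_of_notMem hwy,
            intervalWeight_of_notMem fun h => hwx (hxp.dist_of_mem hc h).1,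
            intervalWeight_of_notMem]
          intro hw
          obtain ⟨z, hz, hwz⟩ := hc.exists_isParent_of_mem_interval hw hwv
          obtain rfl | rfl := htwo z hz
          exacts [hwx hwz, hwy hwz]
      have hsum := finsum_congr hpt
      have lx := hx.2
      have ly := hy.2
      have lp := hxp.2
      rw [finsum_add_distrib (hfin _ _) (hfin _ _),
        finsum_add_distrib (((hsingle _).union (hfin (n + 1) x)).subset
          (Function.support_add _ _)) (hfin _ _),
        finsum_add_distrib (hsingle _) (hfin _ _), finsum_pi_single,
        ih _ (by omega) _ x rfl, ih _ (by omega) _ y rfl,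
        ih _ (by omega) _ p rfl] at hsum
      omega

theorem _root_.HereditaryModular.finsum_intervalWeight_real (hG : HereditaryModular G)
    (hflat : ∀ v, K23Free (G.induce (interval G b v))) (n : ℕ) (v : V) :
    ∑ᶠ w, (intervalWeight G b n v w : ℝ) = n.choose 2 := by
  rw [← hG.finsum_intervalWeight hflat n v]
  exact ((Nat.castAddMonoidHom ℝ).map_finsum
    (hG.finite_support_intervalWeight hflat n v)).symm

theorem _root_.HereditaryModular.finsum_abs_sub_of_isParent (hG : HereditaryModular G)
    (hflat : ∀ v, K23Free (G.induce (interval G b v))) (n : ℕ) (hx : G.IsParent b v x) :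
    ∑ᶠ w, |(intervalWeight G b (n + 1) v w : ℝ) - intervalWeight G b (n + 1) x w| = 2 * n := by
  have hc := hG.1
  have hfin : ∀ k u, (Function.support fun w => (intervalWeight G b k u w : ℝ)).Finite := by
    intro k u
    refine (hG.finite_support_intervalWeight hflat k u).subset fun w hw => ?_
    simpa using hw
  have hpt : ∀ w, |(intervalWeight G b (n + 1) v w : ℝ) - intervalWeight G b (n + 1) x w| =
      ((intervalWeight G b (n + 1) v w : ℝ) - intervalWeight G b n x w) +
        ((intervalWeight G b (n + 1) x w : ℝ) - intervalWeight G b n x w) := by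
    intro w
    by_cases hw : w ∈ interval G b x
    · have hle : intervalWeight G b n x w ≤ intervalWeight G b (n + 1) x w := by
        rw [intervalWeight_of_mem hw, intervalWeight_of_mem hw]
        exact parentWeight_mono G b w (by omega)
      have hle' : (intervalWeight G b n x w : ℝ) ≤ intervalWeight G b (n + 1) x w := by
        exact_mod_cast hle
      rw [hx.intervalWeight_succ hc hw, abs_of_nonpos (by linarith)]
      ring
    · simp [intervalWeight_of_notMem hw]
  have hsub : ∀ k l u t, (Function.support fun w =>
      (intervalWeight G b k u w : ℝ) - intervalWeight G b l t w).Finite := fun k l u t =>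
    ((hfin k u).union (hfin l t)).subset (Function.support_sub _ _)
  rw [finsum_congr hpt, finsum_add_distrib (hsub _ _ _ _) (hsub _ _ _ _),
    finsum_sub_distrib (hfin _ _) (hfin _ _), finsum_sub_distrib (hfin _ _) (hfin _ _)]
  simp only [hG.finsum_intervalWeight_real hflat]
  rw [Nat.choose_succ_succ' n 1, Nat.choose_one_right]
  push_cast
  ring

end SimpleGraph

/-- A hereditary modular graph admitting a basepoint all of whose intervals are
`K_{2,3}`-free satisfies Property A. -/
theorem quadric_flat_intervals_propertyA {V : Type*} (G : SimpleGraph V)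
    (hG : HereditaryModular G)
    (hflat : ∃ b : V, ∀ v : V, K23Free (G.induce (interval G b v))) :
    PropertyA G := by
  obtain ⟨b, hflat⟩ := hflat
  have hM := hG.modular
  have hpos : ∀ n : ℕ, 0 < (n + 2).choose 2 := fun n => Nat.choose_pos (by omega)
  refine ⟨id, fun n => G.intervalWeight b (n + 2),
    fun n => hG.finite_support_intervalWeight hflat _, ?_, ?_, ?_⟩
  · intro n v h
    have hsum := hG.finsum_intervalWeight hflat (n + 2) v
    simp only [h, Pi.zero_apply, finsum_zero] at hsum
    exact (hpos n).ne hsum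
  · intro n v w h
    by_contra hlt
    apply h
    by_cases hw : w ∈ interval G b v
    · refine (SimpleGraph.intervalWeight_of_mem hw).trans (SimpleGraph.parentWeight_of_lt_two ?_)
      simp only [id_eq] at hlt
      omega
    · exact SimpleGraph.intervalWeight_of_notMem hw
  · intro ε hε
    obtain ⟨N, hN⟩ := exists_nat_gt (4 / ε)
    refine ⟨N, fun n hn v v' hvv' => ?_⟩
    have hnum : ∑ᶠ w, |(G.intervalWeight b (n + 2) v w : ℝ) - G.intervalWeight b (n + 2) v' w|
        = 2 * (n + 1) := by
      rcases hM.dist_adj b hvv' with h | h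
      · simpa using hG.finsum_abs_sub_of_isParent hflat (n + 1) ⟨hvv', h⟩
      · simp only [abs_sub_comm (G.intervalWeight b (n + 2) v _ : ℝ)]
        simpa using hG.finsum_abs_sub_of_isParent hflat (n + 1) ⟨hvv'.symm, h⟩
    rw [hnum, hG.finsum_intervalWeight_real hflat, Nat.cast_choose_two]
    have hNn : (N : ℝ) ≤ n := by exact_mod_cast hn
    have h4 : 4 < ε * (n + 2) := by
      rw [div_lt_iff₀ hε] at hN
      nlinarith
    have hn0 : (0 : ℝ) < n + 1 := by positivity
    push_cast
    rw [div_lt_iff₀ (by nlinarith)]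
    nlinarith [mul_lt_mul_of_pos_right h4 hn0]
end

section
/- Let G be a hereditary modular graph and let u, v be vertices of G. Then the interval I(u,v) is isometrically embedded in G: for any two vertices x, y ∈ I(u,v) there is a path from x to y of length d_G(x,y) all of whose vertices lie in I(u,v); equivalently, the distance between x and y in the subgraph induced on I(u,v) equals d_G(x,y). (Graph formulation of: the 1-skeleton of an interval in a quadric complex is isometrically embedded.) -/
namespace SimpleGraph

variable {V W : Type*} {G : SimpleGraph V} {H : SimpleGraph W}

/-- A graph homomorphism does not increase the distance between reachable vertices. -/
theorem Hom.dist_apply_le (f : G →g H) {a b : V} (h : G.Reachable a b) :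
    H.dist (f a) (f b) ≤ G.dist a b := by
  obtain ⟨p, hp⟩ := h.exists_walk_length_eq_dist
  rw [← hp, ← p.length_map f]
  exact dist_le _

/-- Graph isomorphisms between connected graphs preserve distances. -/
theorem Iso.dist_apply (e : G ≃g H) (hG : G.Connected) (a b : V) :
    H.dist (e a) (e b) = G.dist a b := by
  apply le_antisymm (e.toHom.dist_apply_le (hG a b))
  simpa using e.symm.toHom.dist_apply_le ((e.connected_iff.mp hG) (e a) (e b))

/-- The vertices of a geodesic lie in the interval between its endpoints. -/
theorem Walk.mem_interval_of_mem_support (hG : G.Connected) {a b w : V} {p : G.Walk a b}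
    (hp : p.length = G.dist a b) (hw : w ∈ p.support) : w ∈ interval G a b := by
  classical
  have hlen : (p.takeUntil w hw).length + (p.dropUntil w hw).length = p.length := by
    rw [← Walk.length_append, p.take_spec hw]
  have h₁ := dist_le (p.takeUntil w hw)
  have h₂ := dist_le (p.dropUntil w hw)
  have h₃ : G.dist a b ≤ G.dist a w + G.dist w b := hG.dist_triangle
  change G.dist a w + G.dist w b = G.dist a b
  omega

/-- If `x` lies between `u` and `v`, then the interval from `u` to `x` lies between `u` and `v`. -/
theorem interval_subset_of_mem (hG : G.Connected) {u v x : V} (hx : x ∈ interval G u v) :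
    interval G u x ⊆ interval G u v := by
  intro w hw
  change G.dist u x + G.dist x v = G.dist u v at hx
  change G.dist u w + G.dist w x = G.dist u x at hw
  change G.dist u w + G.dist w v = G.dist u v
  have h₁ : G.dist w v ≤ G.dist w x + G.dist x v := hG.dist_triangle
  have h₂ : G.dist u v ≤ G.dist u w + G.dist w v := hG.dist_triangle
  omega

theorem interval_comm (u v : V) : interval G u v = interval G v u := by
  ext w
  change G.dist u w + G.dist w v = G.dist u v ↔ G.dist v w + G.dist w u = G.dist v u
  rw [G.dist_comm (u := v) (v := w), G.dist_comm (u := w) (v := u), G.dist_comm (u := v) (v := u),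
    add_comm]

end SimpleGraph

open SimpleGraph

/-- Any two vertices of an interval in a modular graph are joined by a geodesic in the interval:
it passes through a median of the two vertices and one end of the interval. -/
theorem Modular.exists_walk_support_subset_interval {V : Type*} {G : SimpleGraph V}
    (hG : Modular G) {u v x y : V} (hx : x ∈ interval G u v) (hy : y ∈ interval G u v) :
    ∃ p : G.Walk x y, p.length = G.dist x y ∧ ∀ w ∈ p.support, w ∈ interval G u v := by
  obtain ⟨hc, hmed⟩ := hG
  obtain ⟨m, hux, huy, hxy⟩ := hmed u x y
  obtain ⟨p, hp⟩ := hc.exists_walk_length_eq_dist x m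
  obtain ⟨q, hq⟩ := hc.exists_walk_length_eq_dist m y
  have hgeod {z : V} (hz : z ∈ interval G u v) (hm : m ∈ interval G u z) :
      interval G m z ⊆ interval G u v := by
    rw [interval_comm] at hm ⊢
    refine (interval_subset_of_mem hc hm).trans ?_
    rw [interval_comm]
    exact interval_subset_of_mem hc hz
  refine ⟨p.append q, by rw [Walk.length_append, hp, hq, hxy], fun w hw => ?_⟩
  rcases (Walk.mem_support_append_iff p q).mp hw with hw | hw
  · exact hgeod hx hux (interval_comm x m ▸ Walk.mem_interval_of_mem_support hc hp hw)
  · exact hgeod hy huy (Walk.mem_interval_of_mem_support hc hq hw)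

theorem HereditaryModular.modular_s2 {V : Type*} {G : SimpleGraph V} (hG : HereditaryModular G) :
    Modular G := by
  obtain ⟨hc, h⟩ := hG
  have htop : (⊤ : G.Subgraph).coe.Connected := Subgraph.topIso.connected_iff.mpr hc
  have hdist (x y : (⊤ : G.Subgraph).verts) :
      (⊤ : G.Subgraph).coe.dist x y = G.dist x.1 y.1 :=
    (Subgraph.topIso.dist_apply htop x y).symm
  obtain ⟨-, hmed⟩ := h ⊤ (Subgraph.connected_iff'.mpr htop) hdist
  refine ⟨hc, fun u v w => ?_⟩
  obtain ⟨m, hm⟩ := hmed ⟨u, trivial⟩ ⟨v, trivial⟩ ⟨w, trivial⟩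
  simp only [hdist] at hm
  exact ⟨m.1, hm⟩

/-- Intervals in a hereditary modular graph are isometrically embedded. -/
theorem interval_isometrically_embedded {V : Type*} (G : SimpleGraph V)
    (hG : HereditaryModular G) (u v : V) (x y : V)
    (hx : x ∈ interval G u v) (hy : y ∈ interval G u v) :
    (∃ p : G.Walk x y, p.length = G.dist x y ∧ ∀ w ∈ p.support, w ∈ interval G u v) ∧
    (G.induce (interval G u v)).dist ⟨x, hx⟩ ⟨y, hy⟩ = G.dist x y := by
  obtain ⟨p, hp, hmem⟩ := hG.modular_s2.exists_walk_support_subset_interval hx hy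
  refine ⟨⟨p, hp, hmem⟩, le_antisymm ?_ ?_⟩
  · have hlen : (p.induce _ hmem).length = p.length := by
      rw [← Walk.length_map (Embedding.induce _).toHom, Walk.map_induce]
      rfl
    rw [← hp, ← hlen]
    exact dist_le _
  · exact (Embedding.induce (interval G u v)).toHom.dist_apply_le (p.induce _ hmem).reachable
end

section
/- Let G be a connected K_4-free bridged graph. Then metric spheres in G are triangle-free: for every vertex u and every r ∈ ℕ, there do not exist three pairwise adjacent vertices all at distance exactly r from u. (Graph formulation of: metric spheres in a 2-dimensional systolic complex are triangle-free.) -/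
namespace SimpleGraph

variable {V : Type*} {G : SimpleGraph V}

/-- First steps of geodesics from `a` to two equal or adjacent vertices `p`, `q`, both at the same
distance from `a`, are equal or adjacent; `n` is the length of the resulting closed walk. -/
def FirstStepsNear (G : SimpleGraph V) (n : ℕ) : Prop :=
  ∀ a p q x z : V, G.dist p q ≤ 1 → G.dist a p = G.dist a q → 2 * G.dist a p + G.dist p q = n →
    G.dist a x = 1 → G.dist x p + 1 = G.dist a p →
    G.dist a z = 1 → G.dist z q + 1 = G.dist a q → G.dist x z ≤ 1

lemma Connected.exists_dist_eq_one (hG : G.Connected) {u v : V} (h : 1 ≤ G.dist u v) :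
    ∃ w, G.dist u w = 1 ∧ G.dist w v + 1 = G.dist u v := by
  obtain ⟨p, hp⟩ := hG.exists_walk_length_eq_dist u v
  cases p with
  | nil => simp at h
  | @cons _ w _ hadj p =>
    refine ⟨w, dist_eq_one_iff_adj.2 hadj, ?_⟩
    have h1 := dist_le p
    have h2 := hG.dist_triangle (u := u) (v := w) (w := v)
    rw [dist_eq_one_iff_adj.2 hadj] at h2
    simp only [Walk.length_cons] at hp
    omega

/-- A geodesic with prescribed first step. -/
lemma Connected.exists_geodesic_of_step (hG : G.Connected) (k : ℕ) {a x p : V}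
    (hax : G.dist a x = 1) (hxp : G.dist x p = k) (hap : G.dist a p = k + 1) :
    ∃ g : ℕ → V, g 0 = a ∧ g 1 = x ∧ g (k + 1) = p ∧
      ∀ i j, i ≤ j → j ≤ k + 1 → G.dist (g i) (g j) = j - i := by
  induction k generalizing a x with
  | zero =>
    have hx : x = p := hG.dist_eq_zero_iff.1 hxp
    subst hx
    refine ⟨fun i => if i = 0 then a else x, by simp, by simp, by simp, fun i j hij hj => ?_⟩
    rcases Nat.eq_zero_or_pos i with rfl | hi
    · rcases Nat.eq_zero_or_pos j with rfl | hj0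
      · simp
      · have : j = 1 := by omega
        simp [this, hax]
    · have h1 : i = 1 := by omega
      have h2 : j = 1 := by omega
      simp [h1, h2]
  | succ k ih =>
    obtain ⟨y, hxy, hyp⟩ := hG.exists_dist_eq_one (u := x) (v := p) (by omega)
    obtain ⟨g, g0, -, gk, hg⟩ := ih hxy (by omega) hxp
    refine ⟨fun i => if i = 0 then a else g (i - 1), by simp, by simp [g0], by simp [gk],
      fun i j hij hj => ?_⟩
    rcases Nat.eq_zero_or_pos i with rfl | hi
    · rcases Nat.eq_zero_or_pos j with rfl | hj0
      · simp
      · have hj' : j ≠ 0 := by omega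
        have h1 := hg 0 (j - 1) (by omega) (by omega)
        have h2 := hg (j - 1) (k + 1) (by omega) (by omega)
        rw [g0] at h1
        rw [gk] at h2
        have h3 := hG.dist_triangle (u := a) (v := x) (w := g (j - 1))
        have h4 := hG.dist_triangle (u := a) (v := g (j - 1)) (w := p)
        simp only [if_true, if_neg hj']
        omega
    · have hi' : i ≠ 0 := by omega
      have hj' : j ≠ 0 := by omega
      have h1 := hg (i - 1) (j - 1) (by omega) (by omega)
      simp only [if_neg hi', if_neg hj']
      omega

end SimpleGraph

open SimpleGraph

section Bridged

variable {V : Type*} {G : SimpleGraph V}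

lemma Bridged.false_of_isometric (hbr : Bridged G) {n : ℕ} (hn : 4 ≤ n)
    (f : ℕ → V)
    (hf : ∀ s t, s ≤ t → t < n → G.dist (f s) (f t) = min (t - s) (n - (t - s))) : False := by
  have : NeZero n := ⟨by omega⟩
  have key : ∀ i j : ZMod n,
      G.dist (f i.val) (f j.val) = min (i - j).val (j - i).val := by
    have aux : ∀ i j : ZMod n, i.val ≤ j.val →
        G.dist (f i.val) (f j.val) = min (i - j).val (j - i).val := by
      intro i j hij
      rw [hf _ _ hij j.val_lt]
      have h1 := ZMod.val_sub hij
      have hj := j.val_lt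
      rcases eq_or_ne (j - i) 0 with h0 | h0
      · have : i - j = 0 := by rw [← neg_sub, h0, neg_zero]
        rw [h0, ZMod.val_zero] at h1
        rw [h0, this, ZMod.val_zero]
        omega
      · have h2 : (i - j).val = n - (j - i).val := by
          rw [← neg_sub j i, ZMod.neg_val, if_neg h0]
        rw [h2, h1, min_comm]
    intro i j
    rcases le_total i.val j.val with h | h
    · exact aux i j h
    · rw [SimpleGraph.dist_comm, aux j i h, min_comm]
  have h3 : n = 3 := by
    refine hbr n (fun i => f i.val) ⟨by omega, fun i j hij => ?_, fun i => ?_, key⟩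
    · have h := key i j
      have hij' : f i.val = f j.val := hij
      rw [hij', SimpleGraph.dist_self] at h
      rcases min_eq_iff.1 h.symm with h | h
      · exact sub_eq_zero.1 ((ZMod.val_eq_zero _).1 h.1)
      · exact (sub_eq_zero.1 ((ZMod.val_eq_zero _).1 h.1)).symm
    · have h := key i (i + 1)
      have : Fact (1 < n) := ⟨by omega⟩
      have h1 : i + 1 - i = 1 := by ring
      have h2 : i - (i + 1) = -1 := by ring
      rw [h1, h2, ZMod.neg_val, if_neg one_ne_zero, ZMod.val_one,
        min_eq_right (by omega)] at h
      exact dist_eq_one_iff_adj.1 h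
  omega

lemma Bridged.no_induced_four_cycle (hbr : Bridged G) {a b c e : V}
    (hab : G.dist a b = 1) (hbc : G.dist b c = 1) (hce : G.dist c e = 1) (hae : G.dist a e = 1)
    (hac : G.dist a c = 2) (hbe : G.dist b e = 2) : False := by
  refine hbr.false_of_isometric (n := 4) le_rfl
    (fun i => match i with | 0 => a | 1 => b | 2 => c | _ => e) fun s t hst ht => ?_
  interval_cases t <;> interval_cases s <;> simp [*]

lemma Bridged.no_induced_five_cycle (hbr : Bridged G) {a b c e f : V}
    (hab : G.dist a b = 1) (hbc : G.dist b c = 1) (hce : G.dist c e = 1) (hef : G.dist e f = 1)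
    (haf : G.dist a f = 1) (hac : G.dist a c = 2) (hae : G.dist a e = 2) (hbe : G.dist b e = 2)
    (hbf : G.dist b f = 2) (hcf : G.dist c f = 2) : False := by
  refine hbr.false_of_isometric (n := 5) (by norm_num)
    (fun i => match i with | 0 => a | 1 => b | 2 => c | 3 => e | _ => f) fun s t hst ht => ?_
  interval_cases t <;> interval_cases s <;> simp [*]

end Bridged

namespace SimpleGraph

variable {V : Type*} {G : SimpleGraph V} {M : ℕ}

/-- The triangle condition. -/
lemma exists_common_neighbor (hG : G.Connected) (hS : ∀ n ≤ M, G.FirstStepsNear n)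
    (k : ℕ) (hk : 1 ≤ k) (hM : 2 * k + 1 ≤ M) {u a b : V} (hab : G.dist a b = 1)
    (ha : G.dist u a = k) (hb : G.dist u b = k) :
    ∃ w, G.dist a w = 1 ∧ G.dist b w = 1 ∧ G.dist u w + 1 = k := by
  induction k generalizing u with
  | zero => omega
  | succ k ih =>
    obtain ⟨x, hax, hxu⟩ := hG.exists_dist_eq_one (u := a) (v := u) (by rw [dist_comm]; omega)
    obtain ⟨v, huv, hvb⟩ := hG.exists_dist_eq_one (u := u) (v := b) (by omega)
    have hau := G.dist_comm (u := a) (v := u)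
    have hux := G.dist_comm (u := u) (v := x)
    have hbv := G.dist_comm (u := b) (v := v)
    have hav := G.dist_comm (u := a) (v := v)
    have hbx := G.dist_comm (u := b) (v := x)
    have t1 := hG.dist_triangle (u := u) (v := v) (w := a)
    have t2 := hG.dist_triangle (u := a) (v := b) (w := v)
    have t3 := hG.dist_triangle (u := u) (v := x) (w := b)
    by_cases h : G.dist a v = k + 1
    · have := hS (2 * (k + 1) + 1) hM a u v x b (by omega) (by omega) (by omega) hax (by omega)
        hab (by omega)
      exact ⟨x, hax, by omega, by omega⟩
    · rcases Nat.eq_zero_or_pos k with rfl | hk0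
      · have h1 : a = v := hG.dist_eq_zero_iff.1 (by omega)
        have h2 : b = v := hG.dist_eq_zero_iff.1 (by omega)
        rw [h1, h2, dist_self] at hab
        omega
      · obtain ⟨w, haw, hbw, hw⟩ := ih hk0 (by omega) (u := v) (by omega) (by omega)
        have t4 := hG.dist_triangle (u := u) (v := v) (w := w)
        have t5 := hG.dist_triangle (u := u) (v := w) (w := a)
        have haw' := G.dist_comm (u := a) (v := w)
        exact ⟨w, haw, hbw, by omega⟩

/-- A geodesic leaving a point `b` for a point strictly closer to `o` may be chosen to start by
descending towards `o`. -/
lemma exists_descending_step (hG : G.Connected) (hS : ∀ n ≤ M, G.FirstStepsNear n)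
    (m : ℕ) {o b c : V} (hm : G.dist b c = m) (hlt : G.dist o c < G.dist o b)
    (hM : G.dist o b + G.dist o c + m ≤ M) :
    ∃ s, G.dist b s = 1 ∧ G.dist s c + 1 = m ∧ G.dist o s + 1 = G.dist o b := by
  induction m generalizing b with
  | zero =>
    rw [hG.dist_eq_zero_iff.1 hm] at hlt
    omega
  | succ m ih =>
    obtain ⟨w, hbw, hwc⟩ := hG.exists_dist_eq_one (u := b) (v := c) (by omega)
    have t1 := hG.dist_triangle (u := o) (v := b) (w := w)
    have t2 := hG.dist_triangle (u := o) (v := w) (w := b)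
    have t3 := hG.dist_triangle (u := o) (v := c) (w := w)
    have c1 := G.dist_comm (u := w) (v := b)
    have c2 := G.dist_comm (u := w) (v := c)
    have c3 := G.dist_comm (u := o) (v := w)
    have c4 := G.dist_comm (u := o) (v := b)
    by_cases h1 : G.dist o w + 1 = G.dist o b
    · exact ⟨w, hbw, by omega, h1⟩
    obtain ⟨s, hws, hsc, hos⟩ := ih (b := w) (by omega) (by omega) (by omega)
    have c5 := G.dist_comm (u := o) (v := s)
    by_cases h2 : G.dist o w = G.dist o b
    · obtain ⟨y, hby, hwy, hoy⟩ := exists_common_neighbor hG hS (G.dist o b) (by omega) (by omega)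
        hbw rfl h2
      have c6 := G.dist_comm (u := o) (v := y)
      have := hS (2 * G.dist w o + G.dist o o) (by simp; omega) w o o y s (by simp) rfl rfl hwy
        (by omega) hws (by omega)
      have t4 := hG.dist_triangle (u := y) (v := s) (w := c)
      have t5 := hG.dist_triangle (u := b) (v := y) (w := c)
      exact ⟨y, hby, by omega, hoy⟩
    · have := hS (2 * G.dist w o + G.dist o o) (by simp; omega) w o o b s (by simp) rfl rfl
        (by omega) (by omega) hws (by omega)
      have t4 := hG.dist_triangle (u := b) (v := s) (w := c)
      omega

/-- A geodesic leaving a point `b` for a point not farther from `o` does not start by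
ascending. -/
lemma dist_le_of_step (hG : G.Connected) (hS : ∀ n ≤ M, G.FirstStepsNear n)
    {o b c w : V} (hle : G.dist o c ≤ G.dist o b)
    (hM : G.dist o b + G.dist o c + G.dist b c ≤ M) (hbw : G.dist b w = 1)
    (hwc : G.dist w c + 1 = G.dist b c) : G.dist o w ≤ G.dist o b := by
  by_contra hcon
  have t1 := hG.dist_triangle (u := o) (v := b) (w := w)
  have t3 := hG.dist_triangle (u := o) (v := c) (w := w)
  have c1 := G.dist_comm (u := w) (v := b)
  have c2 := G.dist_comm (u := w) (v := c)
  have c3 := G.dist_comm (u := o) (v := w)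
  have c4 := G.dist_comm (u := o) (v := b)
  obtain ⟨s, hws, hsc, hos⟩ := exists_descending_step hG hS (G.dist w c) (o := o) (b := w) rfl
    (by omega) (by omega)
  have c5 := G.dist_comm (u := o) (v := s)
  have := hS (2 * G.dist w o + G.dist o o) (by simp; omega) w o o b s (by simp) rfl rfl
    (by omega) (by omega) hws (by omega)
  have t4 := hG.dist_triangle (u := b) (v := s) (w := c)
  omega

/-- Nearness of first steps is transitive through a common first step. -/
lemma near_trans (hbr : Bridged G) (hG : G.Connected) (hS : ∀ n ≤ M, G.FirstStepsNear n)
    {a p q x y z : V} (hpq : G.dist p q ≤ 1) (hapq : G.dist a p = G.dist a q)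
    (hn : 2 * G.dist a p + G.dist p q = M + 1)
    (hax : G.dist a x = 1) (hxp : G.dist x p + 1 = G.dist a p)
    (hyp : G.dist y p + 1 = G.dist a p) (hyq : G.dist y q + 1 = G.dist a q)
    (haz : G.dist a z = 1) (hzq : G.dist z q + 1 = G.dist a q)
    (hxy : G.dist x y ≤ 1) (hyz : G.dist y z ≤ 1) : G.dist x z ≤ 1 := by
  by_contra hcon
  have t1 := hG.dist_triangle (u := x) (v := y) (w := z)
  have c1 := G.dist_comm (u := p) (v := x)
  have c2 := G.dist_comm (u := p) (v := y)
  have c3 := G.dist_comm (u := q) (v := y)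
  have c4 := G.dist_comm (u := q) (v := z)
  have hk : 2 ≤ G.dist a p := by
    by_contra hk
    have h1 : x = p := hG.dist_eq_zero_iff.1 (by omega)
    have h2 : y = p := hG.dist_eq_zero_iff.1 (by omega)
    rw [h1, ← h2] at hcon
    omega
  obtain ⟨s, hxs, hys, hps⟩ := exists_common_neighbor hG hS (G.dist p x) (by omega) (by omega)
    (u := p) (a := x) (b := y) (by omega) rfl (by omega)
  obtain ⟨r, hyr, hzr, hqr⟩ := exists_common_neighbor hG hS (G.dist q y) (by omega) (by omega)
    (u := q) (a := y) (b := z) (by omega) rfl (by omega)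
  have c5 := G.dist_comm (u := p) (v := s)
  have c6 := G.dist_comm (u := q) (v := r)
  have c7 := G.dist_comm (u := z) (v := r)
  have hsr := hS (2 * G.dist y p + G.dist p q) (by omega) y p q s r hpq (by omega) rfl hys
    (by omega) hyr (by omega)
  have t2 := hG.dist_triangle (u := a) (v := s) (w := p)
  have t3 := hG.dist_triangle (u := a) (v := r) (w := q)
  have t4 := hG.dist_triangle (u := a) (v := x) (w := s)
  have t5 := hG.dist_triangle (u := a) (v := z) (w := r)
  have t6 := hG.dist_triangle (u := x) (v := s) (w := z)
  have t7 := hG.dist_triangle (u := x) (v := r) (w := z)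
  have t8 := hG.dist_triangle (u := x) (v := s) (w := r)
  have t9 := hG.dist_triangle (u := s) (v := r) (w := z)
  by_cases h1 : G.dist s z = 1
  · exact hbr.no_induced_four_cycle hax hxs h1 haz (by omega) (by omega)
  by_cases h2 : G.dist x r = 1
  · exact hbr.no_induced_four_cycle hax h2 (by omega) haz (by omega) (by omega)
  exact hbr.no_induced_five_cycle hax hxs (c := s) (e := r) (f := z) (by omega) (by omega) haz
    (by omega) (by omega) (by omega) (by omega) (by omega)

/-- Two opposite sides of a geodesic quadrilateral with two opposite edges cannot both be shorter
than both diagonals. -/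
lemma no_long_ladder (hG : G.Connected) (hS : ∀ n ≤ M, G.FirstStepsNear n)
    {p q b s : V} (hpq : G.dist p q = 1) (h1 : 1 ≤ G.dist p b) (hsq : G.dist q s = G.dist p b)
    (hps : G.dist p s = G.dist p b + 1) (hqb : G.dist q b = G.dist p b + 1)
    (hbs : G.dist b s = 1) (hM : 2 * (G.dist p b + 1) ≤ M) : False := by
  obtain ⟨f, hpf, hfb⟩ := hG.exists_dist_eq_one h1
  have t1 := hG.dist_triangle (u := f) (v := b) (w := s)
  have t2 := hG.dist_triangle (u := p) (v := f) (w := s)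
  have := hS (2 * G.dist p s + G.dist s s) (by simp; omega) p s s q f (by simp) rfl rfl hpq
    (by omega) hpf (by omega)
  have t3 := hG.dist_triangle (u := q) (v := f) (w := b)
  omega

/-- Geodesics with a common origin `a` whose endpoints are equal or adjacent have equal or adjacent
first steps as soon as they are joined by a shortcut. -/
lemma near_of_shortcut (hbr : Bridged G) (hG : G.Connected) (hS : ∀ n ≤ M, G.FirstStepsNear n)
    (m : ℕ) {a p q x z b c : V} (hpq : G.dist p q ≤ 1) (hapq : G.dist a p = G.dist a q)
    (hn : 2 * G.dist a p + G.dist p q = M + 1)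
    (hax : G.dist a x = 1) (haz : G.dist a z = 1)
    (hxb : G.dist x b + 1 = G.dist a b) (hzc : G.dist z c + 1 = G.dist a c)
    (hb : G.dist a b + G.dist p b = G.dist a p) (hc : G.dist a c + G.dist q c = G.dist a q)
    (hm : G.dist b c = m) (h1 : m < G.dist a b + G.dist a c)
    (h2 : m + G.dist a b + G.dist a c < M + 1) : G.dist x z ≤ 1 := by
  induction m generalizing p q x z b c with
  | zero =>
    have hbc : b = c := hG.dist_eq_zero_iff.1 hm
    subst hbc
    exact hS (2 * G.dist a b + G.dist b b) (by simp; omega) a b b x z (by simp) rfl rfl hax hxb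
      haz hzc
  | succ m ih =>
    wlog hle : G.dist a b ≤ G.dist a c generalizing p q x z b c
    · rw [dist_comm]
      have e1 := G.dist_comm (u := p) (v := q)
      have e2 := G.dist_comm (u := b) (v := c)
      exact this (p := q) (q := p) (by omega) hapq.symm (by omega) haz hax hzc hxb hc hb
        (by omega) (by omega) (by omega) (by omega)
    have bp := G.dist_comm (u := p) (v := b)
    have cq := G.dist_comm (u := q) (v := c)
    have cp := G.dist_comm (u := p) (v := c)
    have cb := G.dist_comm (u := b) (v := c)
    have qp := G.dist_comm (u := q) (v := p)
    have t1 := hG.dist_triangle (u := x) (v := b) (w := p)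
    have t2 := hG.dist_triangle (u := a) (v := x) (w := p)
    have t3 := hG.dist_triangle (u := z) (v := c) (w := q)
    have t4 := hG.dist_triangle (u := a) (v := z) (w := q)
    have t5 := hG.dist_triangle (u := p) (v := q) (w := c)
    have t6 := hG.dist_triangle (u := a) (v := c) (w := p)
    have t7 := hG.dist_triangle (u := q) (v := p) (w := b)
    by_cases hd : G.dist p c < G.dist p b
    · obtain ⟨s, hbs, hsc, hps⟩ := exists_descending_step hG hS (m + 1) (o := p) (b := b) hm hd
        (by omega)
      have sp := G.dist_comm (u := p) (v := s)
      have u1 := hG.dist_triangle (u := a) (v := b) (w := s)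
      have u2 := hG.dist_triangle (u := a) (v := s) (w := p)
      have u3 := hG.dist_triangle (u := x) (v := b) (w := s)
      have u4 := hG.dist_triangle (u := a) (v := x) (w := s)
      exact ih (b := s) hpq hapq hn hax haz (by omega) hzc (by omega) hc (by omega) (by omega)
        (by omega)
    have transfer : ∀ y t : V, G.dist a y = 1 → G.dist y t + 1 = G.dist a t →
        ∀ v, G.dist a t + G.dist v t = G.dist a v → G.dist y v + 1 = G.dist a v := by
      intro y t hay hyt v hv
      have u1 := hG.dist_triangle (u := y) (v := t) (w := v)
      have u2 := hG.dist_triangle (u := a) (v := y) (w := v)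
      have u3 := G.dist_comm (u := t) (v := v)
      omega
    have hxp := transfer x b hax hxb p hb
    have hzq := transfer z c haz hzc q hc
    have even : ∀ v, 2 * G.dist a v ≤ M → ∀ y y', G.dist a y = 1 → G.dist y v + 1 = G.dist a v →
        G.dist a y' = 1 → G.dist y' v + 1 = G.dist a v → G.dist y y' ≤ 1 := by
      intro v hv y y' h1 h2 h3 h4
      exact hS (2 * G.dist a v + G.dist v v) (by simp; omega) a v v y y' (by simp) rfl rfl h1 h2
        h3 h4
    rcases Nat.eq_zero_or_pos (G.dist p q) with hpq0 | hpq0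
    · have hpq' : p = q := hG.dist_eq_zero_iff.1 hpq0
      subst hpq'
      obtain ⟨w, hbw, hwc⟩ := hG.exists_dist_eq_one (u := b) (v := c) (by omega)
      have d1 := dist_le_of_step hG hS (o := a) (by omega) (by omega) hbw hwc
      have d2 := dist_le_of_step hG hS (o := p) (by omega) (by omega) hbw hwc
      have wp := G.dist_comm (u := p) (v := w)
      have u1 := hG.dist_triangle (u := a) (v := w) (w := p)
      obtain ⟨y, hay, hyw⟩ := hG.exists_dist_eq_one (u := a) (v := w) (by omega)
      have hyp := transfer y w hay hyw p (by omega)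
      have hxy := hS (2 * G.dist a b + G.dist b w) (by omega) a b w x y (by omega) (by omega) rfl
        hax hxb hay hyw
      have hyz := ih hpq rfl hn hay haz hyw hzc (by omega) hc (by omega) (by omega) (by omega)
      exact near_trans hbr hG hS hpq rfl hn hax hxp hyp hyp haz hzq hxy hyz
    · have close : ∀ y, G.dist a y = 1 → G.dist y p + 1 = G.dist a p →
          G.dist y q + 1 = G.dist a q → G.dist x z ≤ 1 := by
        intro y hay hyp hyq
        exact near_trans hbr hG hS hpq hapq hn hax hxp hyp hyq haz hzq
          (even p (by omega) x y hax hxp hay hyp) (even q (by omega) y z hay hyq haz hzq)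
      rcases hle.lt_or_eq with hlt | heq
      · obtain ⟨t, hct, htb, hat⟩ := exists_descending_step hG hS (m + 1) (o := a) (b := c)
          (c := b) (by omega) hlt (by omega)
        have d := dist_le_of_step hG hS (o := p) (b := c) (c := b) (by omega) (by omega) hct
          (by omega)
        have u1 := hG.dist_triangle (u := a) (v := t) (w := p)
        have u2 := hG.dist_triangle (u := q) (v := c) (w := t)
        have u3 := hG.dist_triangle (u := a) (v := t) (w := q)
        have tp := G.dist_comm (u := p) (v := t)
        have tq := G.dist_comm (u := q) (v := t)
        obtain ⟨y, hay, hyt⟩ := hG.exists_dist_eq_one (u := a) (v := t) (by omega)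
        exact close y hay (transfer y t hay hyt p (by omega)) (transfer y t hay hyt q (by omega))
      · by_cases hcp : G.dist p c = G.dist p b
        · exact close z haz (transfer z c haz hzc p (by omega)) hzq
        have u0 := hG.dist_triangle (u := a) (v := b) (w := q)
        have bq := G.dist_comm (u := q) (v := b)
        by_cases hbq : G.dist q b = G.dist p b
        · exact close x hax hxp (transfer x b hax hxb q (by omega))
        obtain ⟨s, hbs, hsc, hqs⟩ := exists_descending_step hG hS (m + 1) (o := q) (b := b)
          (c := c) (by omega) (by omega) (by omega)
        have d := dist_le_of_step hG hS (o := a) (b := b) (c := c) (by omega) (by omega) hbs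
          (by omega)
        have u1 := hG.dist_triangle (u := a) (v := s) (w := q)
        have u2 := hG.dist_triangle (u := a) (v := s) (w := p)
        have u3 := hG.dist_triangle (u := p) (v := b) (w := s)
        have sp := G.dist_comm (u := p) (v := s)
        have sq := G.dist_comm (u := q) (v := s)
        by_cases hps : G.dist p s = G.dist p b
        · obtain ⟨y, hay, hys⟩ := hG.exists_dist_eq_one (u := a) (v := s) (by omega)
          exact close y hay (transfer y s hay hys p (by omega)) (transfer y s hay hys q (by omega))
        · exact (no_long_ladder hG hS (p := p) (q := q) (b := b) (s := s) (by omega) (by omega)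
            (by omega) (by omega) (by omega) hbs (by omega)).elim

end SimpleGraph

lemma Bridged.firstStepsNear {V : Type*} {G : SimpleGraph V} (hbr : Bridged G) (hG : G.Connected)
    (n : ℕ) : G.FirstStepsNear n := by
  induction n using Nat.strong_induction_on with
  | _ n ihn =>
  intro a p q x z hpq hapq hn hax hxp haz hzq
  have hS : ∀ n' ≤ n - 1, G.FirstStepsNear n' := fun n' h => ihn n' (by omega)
  obtain ⟨g, g0, g1, gk, hg⟩ := hG.exists_geodesic_of_step (G.dist x p) hax rfl (by omega)
  obtain ⟨h, h0, h1, hk, hh⟩ := hG.exists_geodesic_of_step (G.dist z q) haz rfl (by omega)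
  rw [hxp] at gk hg
  rw [hzq, ← hapq] at hk hh
  set k := G.dist a p with hkdef
  by_cases hsc : ∃ i j, 1 ≤ i ∧ i ≤ k ∧ 1 ≤ j ∧ j ≤ k ∧ G.dist (g i) (h j) < i + j ∧
      G.dist (g i) (h j) + i + j < n
  · obtain ⟨i, j, hi1, hik, hj1, hjk, hlt1, hlt2⟩ := hsc
    have a1 := hg 0 i (by omega) hik
    have a2 := hg 1 i hi1 hik
    have a3 := hg i k hik le_rfl
    have b1 := hh 0 j (by omega) hjk
    have b2 := hh 1 j hj1 hjk
    have b3 := hh j k hjk le_rfl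
    rw [g0] at a1
    rw [g1] at a2
    rw [gk, dist_comm] at a3
    rw [h0] at b1
    rw [h1] at b2
    rw [hk, dist_comm] at b3
    exact near_of_shortcut hbr hG hS (G.dist (g i) (h j)) (b := g i) (c := h j) hpq (by omega)
      (by omega) hax haz (by omega) (by omega) (by omega) (by omega) rfl (by omega) (by omega)
  rcases Nat.lt_or_ge n 4 with hn4 | hn4
  · have hx : x = p := hG.dist_eq_zero_iff.1 (by omega)
    have hz : z = q := hG.dist_eq_zero_iff.1 (by omega)
    rw [hx, hz]
    exact hpq
  have cross : ∀ i j, i ≤ k → 1 ≤ j → j ≤ k →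
      G.dist (g i) (h j) = min (i + j) (n - (i + j)) := by
    intro i j hik hj1 hjk
    have a1 := hg 0 i (by omega) hik
    have a3 := hg i k hik le_rfl
    have b1 := hh 0 j (by omega) hjk
    have b3 := hh j k hjk le_rfl
    rw [g0, dist_comm] at a1
    rw [gk] at a3
    rw [h0] at b1
    rw [hk, dist_comm] at b3
    have t1 := hG.dist_triangle (u := g i) (v := a) (w := h j)
    have t2 := hG.dist_triangle (u := g i) (v := p) (w := h j)
    have t3 := hG.dist_triangle (u := p) (v := q) (w := h j)
    rcases Nat.eq_zero_or_pos i with rfl | hi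
    · rw [g0] at *
      omega
    · have : ¬(G.dist (g i) (h j) < i + j ∧ G.dist (g i) (h j) + i + j < n) :=
        fun hc => hsc ⟨i, j, hi, hik, hj1, hjk, hc⟩
      omega
  refine (hbr.false_of_isometric hn4 (fun t => if t ≤ k then g t else h (n - t))
    fun s t hst ht => ?_).elim
  by_cases htk : t ≤ k
  · simp only [if_pos htk, if_pos (hst.trans htk), hg s t hst htk]
    omega
  · by_cases hsk : s ≤ k
    · simp only [if_neg htk, if_pos hsk]
      rw [cross s (n - t) hsk (by omega) (by omega)]
      omega
    · simp only [if_neg htk, if_neg hsk]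
      rw [dist_comm, hh (n - t) (n - s) (by omega) (by omega)]
      omega

/-- Metric spheres in a connected `K₄`-free bridged graph are triangle-free. -/
theorem spheres_triangle_free {V : Type*} (G : SimpleGraph V)
    (hconn : G.Connected) (hK4 : K4Free G) (hbr : Bridged G) (u : V) (r : ℕ) :
    ¬ ∃ a b c : V, G.Adj a b ∧ G.Adj a c ∧ G.Adj b c ∧
      G.dist u a = r ∧ G.dist u b = r ∧ G.dist u c = r := by
  induction r with
  | zero =>
    rintro ⟨a, b, c, hab, -, -, ha, hb, -⟩
    rw [← hconn.dist_eq_zero_iff.1 ha, ← hconn.dist_eq_zero_iff.1 hb] at hab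
    exact hab.ne rfl
  | succ r ih =>
    rintro ⟨a, b, c, hab, hac, hbc, ha, hb, hc⟩
    have hS := hbr.firstStepsNear hconn
    have triangle : ∀ {v w : V}, G.Adj v w → G.dist u v = r + 1 → G.dist u w = r + 1 →
        ∃ x, G.Adj v x ∧ G.Adj w x ∧ G.dist u x = r := by
      intro v w hvw hv hw
      obtain ⟨x, hvx, hwx, hx⟩ := exists_common_neighbor hconn (M := 2 * (r + 1) + 1)
        (fun n _ => hS n) (r + 1) (by omega) le_rfl (dist_eq_one_iff_adj.2 hvw) hv hw
      exact ⟨x, dist_eq_one_iff_adj.1 hvx, dist_eq_one_iff_adj.1 hwx, by omega⟩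
    have lower : ∀ {v x y : V}, G.dist u v = r + 1 → G.Adj v x → G.Adj v y → G.dist u x = r →
        G.dist u y = r → x ≠ y → G.Adj x y := by
      intro v x y hv hvx hvy hx hy hxy
      rw [dist_comm] at hv hx hy
      have h := hS (2 * G.dist v u + G.dist u u) v u u x y (by simp) rfl rfl
        (dist_eq_one_iff_adj.2 hvx) (by omega) (dist_eq_one_iff_adj.2 hvy) (by omega)
      have h0 := hconn.pos_dist_of_ne hxy
      exact dist_eq_one_iff_adj.1 (by omega)
    obtain ⟨x, hax, hbx, hx⟩ := triangle hab ha hb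
    obtain ⟨y, hay, hcy, hy⟩ := triangle hac ha hc
    obtain ⟨z, hbz, hcz, hz⟩ := triangle hbc hb hc
    have hxy : x ≠ y := by
      rintro rfl
      exact hK4 ⟨a, b, c, x, hab, hac, hax, hbc, hbx, hcy⟩
    have hxz : x ≠ z := by
      rintro rfl
      exact hK4 ⟨a, b, c, x, hab, hac, hax, hbc, hbx, hcz⟩
    have hyz : y ≠ z := by
      rintro rfl
      exact hK4 ⟨a, b, c, y, hab, hac, hay, hbc, hbz, hcy⟩
    exact ih ⟨x, y, z, lower ha hax hay hx hy hxy, lower hb hbx hbz hx hz hxz,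
      lower hc hcy hcz hy hz hyz, hx, hy, hz⟩
end
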